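/- arXiv:math/0004038 — 4 statements merged into one kernel-verified Lean document; each statement's English description precedes it below -/
import Mathlib

section
/- Let n ∈ ℕ and let u = (f, g) : ℂ → ℂ × ℂⁿ be continuous on the closed unit disc D and holomorphic (complex differentiable) at every point of the open unit disc, such that for every z with |z| = 1 one has f(z) ∈ {i z t : t ∈ ℝ} and every coordinate of g(z) is real. Then there exist a₀ ∈ ℂ, s ∈ ℝ and σ ∈ ℝⁿ such that for all z ∈ D, f(z) = a₀ + i s z − (conj a₀) z² and g(z) = σ. Conversely, every u of this form satisfies all the stated conditions. -/
open Metric Complex in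
/-- A function holomorphic on the open unit disc, continuous on the closed one, and real on the
unit circle is real on the closed disc. -/
theorem DiffContOnCl.im_eq_zero_of_im_eq_zero_on_sphere {h : ℂ → ℂ}
    (hd : DiffContOnCl ℂ h (ball 0 1)) (hb : ∀ z : ℂ, ‖z‖ = 1 → (h z).im = 0)
    {z : ℂ} (hz : ‖z‖ ≤ 1) : (h z).im = 0 := by
  have key : ∀ c : ℂ, c.re = 0 → ‖cexp (c * h z)‖ ≤ 1 := by
    intro c hc
    have hE : DiffContOnCl ℂ (fun w => cexp (c * h w)) (ball 0 1) :=
      (Differentiable.diffContOnCl (s := Set.univ)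
        (f := fun w : ℂ => cexp (c * w)) (by fun_prop)).comp hd (Set.mapsTo_univ _ _)
    refine norm_le_of_forall_mem_frontier_norm_le isBounded_ball hE (fun w hw => ?_) ?_
    · rw [frontier_ball _ one_ne_zero, mem_sphere_zero_iff_norm] at hw
      simp [norm_exp, hc, hb w hw]
    · rw [closure_ball _ one_ne_zero]
      simpa using hz
  have h₁ := key I (by simp)
  have h₂ := key (-I) (by simp)
  simp only [norm_exp, Real.exp_le_one_iff] at h₁ h₂
  simp at h₁ h₂
  linarith

open Metric Complex in
/-- A function holomorphic on the open unit disc, continuous on the closed one, and real on the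
unit circle is a real constant. -/
theorem DiffContOnCl.exists_real_eq_of_im_eq_zero_on_sphere {h : ℂ → ℂ}
    (hd : DiffContOnCl ℂ h (ball 0 1)) (hb : ∀ z : ℂ, ‖z‖ = 1 → (h z).im = 0) :
    ∃ s : ℝ, ∀ z : ℂ, ‖z‖ ≤ 1 → h z = s := by
  have him : ∀ z : ℂ, ‖z‖ ≤ 1 → (h z).im = 0 := fun z hz =>
    hd.im_eq_zero_of_im_eq_zero_on_sphere hb hz
  have hw_im : ∀ z : ℂ, ‖z‖ ≤ 1 → (h z - h 0 + I).im = 1 := fun z hz => by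
    simp [him z hz, him 0 (by simp)]
  have hw : DiffContOnCl ℂ (fun z => h z - h 0 + I) (ball 0 1) := (hd.sub_const _).add_const _
  have hinv : DiffContOnCl ℂ (fun z => h z - h 0 + I)⁻¹ (ball 0 1) := by
    refine hw.inv fun z hz h0 => ?_
    rw [closure_ball _ one_ne_zero, mem_closedBall_zero_iff] at hz
    have := hw_im z hz
    simp [h0] at this
  have hmax : IsMaxOn (norm ∘ (fun z => h z - h 0 + I)⁻¹) (ball 0 1) 0 := by
    intro z hz
    have h1 : 1 ≤ ‖h z - h 0 + I‖ := by
      have := abs_im_le_norm (h z - h 0 + I)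
      rwa [hw_im z (mem_ball_zero_iff.mp hz).le, abs_one] at this
    simpa using inv_le_one_of_one_le₀ h1
  refine ⟨(h 0).re, fun z hz => ?_⟩
  have heq := eqOn_closedBall_of_isMaxOn_norm hinv hmax (mem_closedBall_zero_iff.mpr hz)
  have h0 : h z - h 0 + I = I := by simpa using inv_injective heq
  have hz0 : h z = h 0 := by linear_combination h0
  rw [hz0]
  exact Complex.ext (by simp) (by simp [him 0 (by simp)])

open Metric Complex in
/-- A function holomorphic on the open unit disc, continuous on the closed one, with values in
`i z ℝ` at the points `z` of the unit circle is a quadratic polynomial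
`a₀ + i s z - conj a₀ · z²`. -/
theorem DiffContOnCl.exists_eq_quadratic_of_tangent_on_sphere {f : ℂ → ℂ}
    (hd : DiffContOnCl ℂ f (ball 0 1))
    (hb : ∀ z : ℂ, ‖z‖ = 1 → ∃ t : ℝ, f z = I * z * (t : ℂ)) :
    ∃ (a₀ : ℂ) (s : ℝ), ∀ z : ℂ, ‖z‖ ≤ 1 →
      f z = a₀ + I * (s : ℂ) * z - (starRingEnd ℂ) a₀ * z ^ 2 := by
  have hball : ball (0 : ℂ) 1 ∈ nhds 0 := ball_mem_nhds 0 one_pos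
  have hslope : DiffContOnCl ℂ (dslope f 0) (ball 0 1) :=
    ⟨(differentiableOn_dslope hball).mpr hd.differentiableOn,
      (continuousOn_dslope (Filter.mem_of_superset hball subset_closure)).mpr
        ⟨hd.continuousOn, hd.differentiableAt isOpen_ball (mem_ball_self one_pos)⟩⟩
  have hlin : DiffContOnCl ℂ (fun z => (starRingEnd ℂ) (f 0) * z) (ball 0 1) :=
    Differentiable.diffContOnCl (by fun_prop)
  have hz_slope : ∀ z, z * dslope f 0 z = f z - f 0 := fun z => by
    simpa using sub_smul_dslope f 0 z
  obtain ⟨s, hs⟩ := ((hslope.add hlin).const_smul (-I)).exists_real_eq_of_im_eq_zero_on_sphere (by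
    intro z hz
    obtain ⟨t, ht⟩ := hb z hz
    have hzz : (starRingEnd ℂ) z * z = 1 := by simp [conj_mul', hz]
    have hval : dslope f 0 z = I * t - (starRingEnd ℂ) z * f 0 := by
      linear_combination (-dslope f 0 z + I * t) * hzz + (starRingEnd ℂ) z * hz_slope z +
        (starRingEnd ℂ) z * ht
    simp [hval]
    ring)
  refine ⟨f 0, s, fun z hz => ?_⟩
  have hsz : -I * (dslope f 0 z + (starRingEnd ℂ) (f 0) * z) = s := hs z hz
  linear_combination -hz_slope z + I * z * hsz +
    z * (dslope f 0 z + (starRingEnd ℂ) (f 0) * z) * I_sq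

/-- The polynomial `a₀ + i s z - conj a₀ · z²` takes values in `i z ℝ` on the unit circle. -/
theorem Complex.exists_quadratic_eq_I_mul_mul_real (a₀ : ℂ) (s : ℝ) {z : ℂ} (hz : ‖z‖ = 1) :
    ∃ t : ℝ, a₀ + I * (s : ℂ) * z - (starRingEnd ℂ) a₀ * z ^ 2 = I * z * (t : ℂ) := by
  refine ⟨s - 2 * ((starRingEnd ℂ) a₀ * z).im, ?_⟩
  have hzz : (starRingEnd ℂ) z * z = 1 := by simp [conj_mul', hz]
  have hsub := sub_conj ((starRingEnd ℂ) a₀ * z)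
  simp only [map_mul, conj_conj] at hsub
  push_cast at hsub ⊢
  linear_combination -a₀ * hzz - z * hsub

/-- Proposition 2.1 (kernel description): a map `u = (f, g) : ℂ → ℂ × ℂⁿ`, continuous on
the closed unit disc, holomorphic on the open unit disc, with boundary values
`f z ∈ i z ℝ` and `g z ∈ ℝⁿ` for `|z| = 1`, is exactly of the form
`f z = a₀ + i s z - conj a₀ · z²`, `g z = σ ∈ ℝⁿ` constant, on the closed disc. -/
theorem kernel_of_CR_operator (n : ℕ) (f : ℂ → ℂ) (g : ℂ → Fin n → ℂ) :
    (ContinuousOn f {z : ℂ | ‖z‖ ≤ 1} ∧ ContinuousOn g {z : ℂ | ‖z‖ ≤ 1} ∧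
      (∀ z : ℂ, ‖z‖ < 1 → DifferentiableAt ℂ f z ∧ DifferentiableAt ℂ g z) ∧
      (∀ z : ℂ, ‖z‖ = 1 →
        (∃ t : ℝ, f z = Complex.I * z * (t : ℂ)) ∧ ∀ k, ∃ r : ℝ, g z k = (r : ℂ))) ↔
    ∃ (a₀ : ℂ) (s : ℝ) (σ : Fin n → ℝ),
      (∀ z : ℂ, ‖z‖ ≤ 1 →
        f z = a₀ + Complex.I * (s : ℂ) * z - (starRingEnd ℂ) a₀ * z ^ 2) ∧
      ∀ z : ℂ, ‖z‖ ≤ 1 → ∀ k, g z k = ((σ k : ℝ) : ℂ) := by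
  have hcl : {z : ℂ | ‖z‖ ≤ 1} = closure (Metric.ball 0 1) := by
    rw [closure_ball _ one_ne_zero]
    ext z
    simp
  constructor
  · rintro ⟨hf, hg, hdiff, hb⟩
    rw [hcl] at hf hg
    have hfd : DiffContOnCl ℂ f (Metric.ball 0 1) :=
      ⟨fun z hz => (hdiff z (mem_ball_zero_iff.mp hz)).1.differentiableWithinAt, hf⟩
    have hgd : ∀ k, DiffContOnCl ℂ (fun z => g z k) (Metric.ball 0 1) := fun k =>
      ⟨fun z hz =>
        (differentiableAt_pi.mp (hdiff z (mem_ball_zero_iff.mp hz)).2 k).differentiableWithinAt,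
        continuousOn_pi.mp hg k⟩
    obtain ⟨a₀, s, hs⟩ := hfd.exists_eq_quadratic_of_tangent_on_sphere fun z hz => (hb z hz).1
    choose σ hσ using fun k => (hgd k).exists_real_eq_of_im_eq_zero_on_sphere fun z hz => by
      obtain ⟨r, hr⟩ := (hb z hz).2 k
      simp [hr]
    exact ⟨a₀, s, σ, hs, fun z hz k => hσ k z hz⟩
  · rintro ⟨a₀, s, σ, hf, hg⟩
    have hg' : ∀ z : ℂ, ‖z‖ ≤ 1 → g z = fun k => (σ k : ℂ) := fun z hz => funext (hg z hz)
    refine ⟨ContinuousOn.congr (by fun_prop) hf, continuousOn_const.congr hg', fun z hz => ?_,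
      fun z hz => ⟨?_, fun k => ⟨σ k, hg z hz.le k⟩⟩⟩
    · have hnhds : ∀ᶠ w : ℂ in nhds z, ‖w‖ ≤ 1 :=
        (continuous_norm.continuousAt.eventually_lt_const hz).mono fun _ => le_of_lt
      have hquad : DifferentiableAt ℂ
          (fun w : ℂ => a₀ + Complex.I * (s : ℂ) * w - (starRingEnd ℂ) a₀ * w ^ 2) z := by
        fun_prop
      exact ⟨hquad.congr_of_eventuallyEq (hnhds.mono hf),
        (differentiableAt_const _).congr_of_eventuallyEq (hnhds.mono hg')⟩
    · rw [hf z hz.le]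
      exact Complex.exists_quadratic_eq_I_mul_mul_real a₀ s hz
end

section
/- Let n ∈ ℕ. The set of maps u : ℂ → ℂ × ℂⁿ that are continuous on the closed unit disc D, holomorphic at every point of the open unit disc, and satisfy the boundary condition u(z) ∈ {i z t : t ∈ ℝ} × ℝⁿ for all |z| = 1 (first component a real multiple of iz, all coordinates of the second component real), is a real vector subspace (under pointwise addition and real scalar multiplication) of the space of functions D → ℂ × ℂⁿ, and its real dimension equals n + 3. -/
/-- A function holomorphic on the open unit disc and continuous on the closed one whose real part
vanishes on the unit circle has vanishing real part on the closed disc. -/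
lemma re_eq_zero_of_re_eq_zero_on_circle {f : ℂ → ℂ}
    (hf : DiffContOnCl ℂ f (Metric.ball 0 1)) (hre : ∀ z : ℂ, ‖z‖ = 1 → (f z).re = 0)
    {z : ℂ} (hz : ‖z‖ ≤ 1) : (f z).re = 0 := by
  have key : ∀ g : ℂ → ℂ, DiffContOnCl ℂ g (Metric.ball 0 1) →
      (∀ z : ℂ, ‖z‖ = 1 → (g z).re = 0) → (g z).re ≤ 0 := by
    intro g hg hgre
    have hexp : DiffContOnCl ℂ (fun w => Complex.exp (g w)) (Metric.ball 0 1) :=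
      Complex.differentiable_exp.comp_diffContOnCl hg
    have hle := Complex.norm_le_of_forall_mem_frontier_norm_le (C := 1) Metric.isBounded_ball hexp
      (fun w hw => by
        rw [frontier_ball (0 : ℂ) one_ne_zero, mem_sphere_zero_iff_norm] at hw
        rw [Complex.norm_exp, hgre w hw, Real.exp_zero])
      (z := z) (by rwa [closure_ball (0 : ℂ) one_ne_zero, mem_closedBall_zero_iff])
    rwa [Complex.norm_exp, Real.exp_le_one_iff] at hle
  have hneg := key (fun w => -f w) hf.neg (fun w hw => by simp [hre w hw])
  rw [Complex.neg_re] at hneg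
  linarith [key f hf hre]

/-- A function holomorphic on the open unit disc and continuous on the closed one whose real part
vanishes on the unit circle is constant on the closed disc. -/
lemma eq_apply_zero_of_re_eq_zero_on_circle {f : ℂ → ℂ}
    (hf : DiffContOnCl ℂ f (Metric.ball 0 1)) (hre : ∀ z : ℂ, ‖z‖ = 1 → (f z).re = 0)
    {z : ℂ} (hz : ‖z‖ ≤ 1) : f z = f 0 := by
  have hre' : ∀ w : ℂ, ‖w‖ ≤ 1 → (1 + (f w - f 0)).re = 1 := fun w hw => by
    simp [re_eq_zero_of_re_eq_zero_on_circle hf hre hw,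
      re_eq_zero_of_re_eq_zero_on_circle hf hre (z := 0) (by simp)]
  have hcl : closure (Metric.ball (0 : ℂ) 1) = Metric.closedBall 0 1 :=
    closure_ball 0 one_ne_zero
  have hg : DiffContOnCl ℂ (fun w => 1 + (f w - f 0)) (Metric.ball 0 1) :=
    (hf.sub_const (f 0)).const_add 1
  have hinv : DiffContOnCl ℂ (fun w => 1 + (f w - f 0))⁻¹ (Metric.ball 0 1) :=
    hg.inv fun w hw h0 => by
      rw [hcl, mem_closedBall_zero_iff] at hw
      have := hre' w hw
      rw [h0] at this
      simp at this
  have hmax : IsMaxOn (norm ∘ (fun w => 1 + (f w - f 0))⁻¹) (Metric.ball 0 1) 0 := by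
    intro w hw
    have h1 := (Complex.re_le_norm _).trans' (hre' w (mem_ball_zero_iff.1 hw).le).ge
    simpa using inv_le_one_of_one_le₀ h1
  have h := Complex.eqOn_closedBall_of_isMaxOn_norm hinv hmax (mem_closedBall_zero_iff.2 hz)
  simpa [sub_eq_zero] using h

/-- Holomorphic discs with boundary condition `f z ∈ i z ℝ` are the quadratic polynomials
`a - conj a * z ^ 2 + i b z` with `b` real. -/
lemma exists_quadratic_of_mem_I_mul_on_circle {f : ℂ → ℂ}
    (hc : ContinuousOn f (Metric.closedBall 0 1)) (hd : DifferentiableOn ℂ f (Metric.ball 0 1))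
    (hb : ∀ z : ℂ, ‖z‖ = 1 → ∃ t : ℝ, f z = Complex.I * z * t) :
    ∃ (a : ℂ) (b : ℝ), ∀ z : ℂ, ‖z‖ ≤ 1 →
      f z = a - starRingEnd ℂ a * z ^ 2 + Complex.I * b * z := by
  set a := f 0 with ha
  set g : ℂ → ℂ := fun z => f z - a + starRingEnd ℂ a * z ^ 2 with hg
  have hg0 : g 0 = 0 := by simp [hg, ha]
  have hgc : ContinuousOn g (Metric.closedBall 0 1) := by fun_prop
  have hgd : DifferentiableOn ℂ g (Metric.ball 0 1) := by fun_prop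
  have hgd0 : DifferentiableAt ℂ g 0 :=
    hgd.differentiableAt (Metric.ball_mem_nhds 0 one_pos)
  have hmul : ∀ z, g z = z * dslope g 0 z := fun z => by
    simpa [hg0] using (sub_smul_dslope g 0 z).symm
  have hh : DiffContOnCl ℂ (dslope g 0) (Metric.ball 0 1) := by
    refine ⟨(Complex.differentiableOn_dslope (Metric.ball_mem_nhds 0 one_pos)).2 hgd, ?_⟩
    rw [closure_ball (0 : ℂ) one_ne_zero]
    exact (continuousOn_dslope (Metric.closedBall_mem_nhds 0 one_pos)).2 ⟨hgc, hgd0⟩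
  have hre : ∀ z : ℂ, ‖z‖ = 1 → (dslope g 0 z).re = 0 := by
    intro z hz
    obtain ⟨t, ht⟩ := hb z hz
    have hzz : z * starRingEnd ℂ z = 1 := by
      rw [Complex.mul_conj, Complex.normSq_eq_norm_sq, hz]; simp
    have hval : dslope g 0 z
        = Complex.I * t - (a * starRingEnd ℂ z - starRingEnd ℂ (a * starRingEnd ℂ z)) := by
      have h1 : dslope g 0 z = starRingEnd ℂ z * g z := by
        rw [hmul z]; linear_combination (-dslope g 0 z) * hzz
      rw [h1, map_mul, Complex.conj_conj]
      simp only [hg, ht]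
      linear_combination (Complex.I * t + starRingEnd ℂ a * z) * hzz
    rw [hval]
    simp
  have hconst : ∀ z : ℂ, ‖z‖ ≤ 1 → dslope g 0 z = dslope g 0 0 := fun z hz =>
    eq_apply_zero_of_re_eq_zero_on_circle hh hre hz
  have hre0 : (dslope g 0 0).re = 0 :=
    re_eq_zero_of_re_eq_zero_on_circle hh hre (by simp)
  refine ⟨a, (dslope g 0 0).im, fun z hz => ?_⟩
  have hI : dslope g 0 0 = Complex.I * (dslope g 0 0).im := by
    apply Complex.ext
    · rw [hre0]; simp
    · simp
  have hz' := hmul z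
  rw [hconst z hz, hI] at hz'
  simp only [hg] at hz' ⊢
  linear_combination hz'

/-- A function holomorphic on the open unit disc and continuous on the closed one that is real on
the unit circle is a real constant on the closed disc. -/
lemma exists_real_const_of_real_on_circle {f : ℂ → ℂ}
    (hc : ContinuousOn f (Metric.closedBall 0 1)) (hd : DifferentiableOn ℂ f (Metric.ball 0 1))
    (hb : ∀ z : ℂ, ‖z‖ = 1 → ∃ r : ℝ, f z = r) :
    ∃ r : ℝ, ∀ z : ℂ, ‖z‖ ≤ 1 → f z = r := by
  have hf : DiffContOnCl ℂ (fun z => Complex.I * f z) (Metric.ball 0 1) := by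
    refine ⟨by fun_prop, ?_⟩
    rw [closure_ball (0 : ℂ) one_ne_zero]
    fun_prop
  have hconst : ∀ z : ℂ, ‖z‖ ≤ 1 → f z = f 0 := fun z hz => by
    have h := eq_apply_zero_of_re_eq_zero_on_circle hf
      (fun w hw => by obtain ⟨r, hr⟩ := hb w hw; simp [hr]) hz
    simpa using h
  obtain ⟨r, hr⟩ := hb 1 (by simp)
  exact ⟨r, fun z hz => by rw [hconst z hz, ← hconst 1 (by simp), hr]⟩

/-- The parametrization `(a, b, r) ↦ (z ↦ (a - conj a * z ^ 2 + i b z, r))` of the kernel. -/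
noncomputable def discParametrization (n : ℕ) :
    ℂ × ℝ × (Fin n → ℝ) →ₗ[ℝ] ({z : ℂ // ‖z‖ ≤ 1} → ℂ × (Fin n → ℂ)) where
  toFun q z := (q.1 - starRingEnd ℂ q.1 * z.val ^ 2 + Complex.I * q.2.1 * z.val,
    fun k => (q.2.2 k : ℂ))
  map_add' q q' := by
    ext z
    · simp; ring
    · simp
  map_smul' c q := by
    ext z
    · simp; ring
    · simp

lemma discParametrization_injective (n : ℕ) : Function.Injective (discParametrization n) := by
  rw [← LinearMap.ker_eq_bot, LinearMap.ker_eq_bot']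
  rintro ⟨a, b, r⟩ h
  have h0 := congrFun h ⟨0, by simp⟩
  have h1 := congrFun h ⟨1, by simp⟩
  simp only [discParametrization, LinearMap.coe_mk, AddHom.coe_mk, Pi.zero_apply,
    Prod.ext_iff, Prod.fst_zero, Prod.snd_zero] at h0 h1
  have ha : a = 0 := by simpa using h0.1
  have hb : b = 0 := by simpa [ha] using h1.1
  have hr : r = 0 := by
    ext k
    simpa using congrFun h0.2 k
  simp [ha, hb, hr]

/-- Proposition 2.1 (index computation): the space of maps of the closed unit disc `D` into
`ℂ × ℂⁿ` that are continuous on `D`, holomorphic on the open unit disc, and satisfy the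
totally real boundary condition `u z ∈ i z ℝ × ℝⁿ` for `|z| = 1`, is a real vector subspace
of the space of functions `D → ℂ × ℂⁿ` of real dimension `n + 3`. -/
theorem kernel_CR_is_subspace_of_dim_n_add_three (n : ℕ) :
    ∃ p : Submodule ℝ ({z : ℂ // ‖z‖ ≤ 1} → ℂ × (Fin n → ℂ)),
      (p : Set ({z : ℂ // ‖z‖ ≤ 1} → ℂ × (Fin n → ℂ))) =
        {u | ∃ U : ℂ → ℂ × (Fin n → ℂ),
          (∀ z : {z : ℂ // ‖z‖ ≤ 1}, U z.val = u z) ∧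
          ContinuousOn U {z : ℂ | ‖z‖ ≤ 1} ∧
          (∀ z : ℂ, ‖z‖ < 1 → DifferentiableAt ℂ U z) ∧
          (∀ z : ℂ, ‖z‖ = 1 →
            (∃ t : ℝ, (U z).1 = Complex.I * z * (t : ℂ)) ∧
            ∀ k, ∃ r : ℝ, (U z).2 k = (r : ℂ))} ∧
      Module.finrank ℝ p = n + 3 := by
  have hball : {z : ℂ | ‖z‖ ≤ 1} = Metric.closedBall 0 1 := by ext; simp
  refine ⟨LinearMap.range (discParametrization n), ?_, ?_⟩
  · ext u
    simp only [SetLike.mem_coe, LinearMap.mem_range, Set.mem_ofPred_eq]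
    constructor
    · rintro ⟨⟨a, b, r⟩, rfl⟩
      refine ⟨fun z => (a - starRingEnd ℂ a * z ^ 2 + Complex.I * b * z, fun k => (r k : ℂ)),
        fun z => rfl, by fun_prop, fun z _ => by fun_prop, fun z hz => ⟨?_, fun k => ⟨r k, rfl⟩⟩⟩
      have hzz : z * starRingEnd ℂ z = 1 := by
        rw [Complex.mul_conj, Complex.normSq_eq_norm_sq, hz]; simp
      have him : a * starRingEnd ℂ z - starRingEnd ℂ a * z
          = Complex.I * (2 * (a * starRingEnd ℂ z).im : ℝ) := by
        apply Complex.ext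
        · simp
        · simp; ring
      refine ⟨b + 2 * (a * starRingEnd ℂ z).im, ?_⟩
      rw [Complex.ofReal_add]
      linear_combination z * him - a * hzz
    · rintro ⟨U, hU, hc, hd, hb⟩
      rw [hball] at hc
      have hd' : DifferentiableOn ℂ U (Metric.ball 0 1) := fun z hz =>
        (hd z (mem_ball_zero_iff.1 hz)).differentiableWithinAt
      obtain ⟨a, b, hab⟩ := exists_quadratic_of_mem_I_mul_on_circle hc.fst hd'.fst
        fun z hz => (hb z hz).1
      choose r hr using fun k => exists_real_const_of_real_on_circle
        (f := fun z => (U z).2 k) (by fun_prop) (differentiableOn_pi.1 hd'.snd k)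
        fun z hz => (hb z hz).2 k
      refine ⟨(a, b, r), funext fun z => ?_⟩
      rw [← hU z]
      exact Prod.ext (hab z z.2).symm (funext fun k => (hr k z z.2).symm)
  · rw [LinearMap.finrank_range_of_inj (discParametrization_injective n)]
    simp
    ring
end

section
/- Let n ∈ ℕ and let w : ℂ → ℂ × ℂⁿ be a C^∞ map (smooth in the real sense). Then there exists a map u : ℂ → ℂ × ℂⁿ, smooth in the real sense on all of ℂ, such that ∂_x u(z) + i ∂_y u(z) = w(z) for every z in the open unit disc, and u(z) ∈ {i z t : t ∈ ℝ} × ℝⁿ for every z with |z| = 1. -/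
open Complex MeasureTheory Set Filter Topology

/-- The Cauchy–Riemann operator `∂ₓ + i ∂_y`. -/
noncomputable def dbar (f : ℂ → ℂ) (z : ℂ) : ℂ := fderiv ℝ f z 1 + I * fderiv ℝ f z I

lemma exp_neg_mul_dbar (f : ℂ → ℂ) (z : ℂ) (θ : ℝ) :
    exp (-(θ * I)) * dbar f z =
      fderiv ℝ f z (exp (θ * I)) + I * fderiv ℝ f z (I * exp (θ * I)) := by
  have h (a b : ℝ) : fderiv ℝ f z (a + b * I) = a * fderiv ℝ f z 1 + b * fderiv ℝ f z I := by
    have : (a + b * I : ℂ) = a • (1 : ℂ) + b • I := by simp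
    rw [this, map_add, map_smul, map_smul]; simp
  have h1 : exp (θ * I) = (Real.cos θ : ℝ) + (Real.sin θ : ℝ) * I := by
    rw [exp_mul_I]; simp
  have h2 : I * exp (θ * I) = ((-Real.sin θ : ℝ) : ℂ) + (Real.cos θ : ℝ) * I := by
    rw [h1, mul_add]; push_cast; linear_combination (Complex.sin θ) * I_mul_I
  have h3 : exp (-(θ * I)) = (Real.cos θ : ℝ) - (Real.sin θ : ℝ) * I := by
    rw [← neg_mul, exp_mul_I]; simp [sub_eq_add_neg]
  rw [h2, h1, h, h, h3, dbar]
  push_cast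
  linear_combination (-Complex.sin θ * fderiv ℝ f z I) * I_mul_I

/-- The **Cauchy–Pompeiu formula** for compactly supported functions. -/
lemma integral_inv_mul_dbar {F : ℂ → ℂ} (hF : ContDiff ℝ 1 F) (hc : HasCompactSupport F) :
    ∫ ζ, ζ⁻¹ * dbar F ζ = -(2 * Real.pi) * F 0 := by
  let A : ℝ × ℝ → ℂ := fun p => fderiv ℝ F (p.1 * exp (p.2 * I)) (exp (p.2 * I))
  let B : ℝ × ℝ → ℂ := fun p => fderiv ℝ F (p.1 * exp (p.2 * I)) (I * exp (p.2 * I))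
  have hdF : Continuous (fderiv ℝ F) := hF.continuous_fderiv one_ne_zero
  have hA : Continuous A := by
    exact (hdF.comp (by fun_prop)).clm_apply (by fun_prop)
  have hB : Continuous B := by
    exact (hdF.comp (by fun_prop)).clm_apply (by fun_prop)
  obtain ⟨R, hR⟩ := hc.isBounded.subset_closedBall 0
  have hzero (z : ℂ) (hz : R < ‖z‖) : z ∉ tsupport F := fun h => by
    have := hR h
    simp at this; linarith
  have hz0 (r θ : ℝ) (h : R < r) : (r * exp (θ * I) : ℂ) ∉ tsupport F := by
    apply hzero
    rw [norm_mul, norm_exp_ofReal_mul_I, mul_one, norm_real]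
    exact h.trans_le (le_abs_self r)
  have hIntOn (C : ℝ × ℝ → ℂ) (hC : Continuous C) (hC0 : ∀ p : ℝ × ℝ, R < p.1 → C p = 0) :
      IntegrableOn C (Ioi (0 : ℝ) ×ˢ Ioo (-Real.pi) Real.pi) := by
    refine (IntegrableOn.of_forall_sdiff_eq_zero (s := Icc (0 : ℝ) R ×ˢ Icc (-Real.pi) Real.pi)
      (hC.continuousOn.integrableOn_compact (isCompact_Icc.prod isCompact_Icc))
      (measurableSet_Ioi.prod measurableSet_Ioo) ?_)
    rintro ⟨r, θ⟩ ⟨⟨h1, h2⟩, h3⟩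
    apply hC0
    by_contra! h
    exact h3 ⟨⟨le_of_lt h1, h⟩, Ioo_subset_Icc_self h2⟩
  have hA0 (p : ℝ × ℝ) (h : R < p.1) : A p = 0 := by
    have := image_eq_zero_of_notMem_tsupport
      (fun h' => hz0 p.1 p.2 h (tsupport_fderiv_subset ℝ h'))
    simp only [A, this]; simp
  have hB0 (p : ℝ × ℝ) (h : R < p.1) : B p = 0 := by
    have := image_eq_zero_of_notMem_tsupport
      (fun h' => hz0 p.1 p.2 h (tsupport_fderiv_subset ℝ h'))
    simp only [B, this]; simp
  have iA := hIntOn A hA hA0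
  have iB := hIntOn B hB hB0
  have hFd (z : ℂ) : HasFDerivAt F (fderiv ℝ F z) z :=
    (hF.differentiable one_ne_zero z).hasFDerivAt
  have intA : ∫ p in Ioi (0 : ℝ) ×ˢ Ioo (-Real.pi) Real.pi, A p = -(2 * Real.pi) * F 0 := by
    rw [Measure.volume_eq_prod, ← setIntegral_prod_swap, setIntegral_prod]
    · have key (θ : ℝ) : ∫ r in Ioi (0 : ℝ), A (r, θ) = - F 0 := by
        have hd (r : ℝ) : HasDerivAt (fun r : ℝ => F (r * exp (θ * I))) (A (r, θ)) r := by
          have : HasDerivAt (fun r : ℝ => (r * exp (θ * I) : ℂ)) (exp (θ * I)) r := by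
            simpa using (hasDerivAt_id r).ofReal_comp.mul_const (exp (θ * I))
          exact (hFd _).comp_hasDerivAt r this
        rw [integral_Ioi_of_hasDerivAt_of_tendsto' (fun r _ => hd r) (m := 0)]
        · simp
        · refine (IntegrableOn.of_forall_sdiff_eq_zero (s := Icc (0 : ℝ) R)
            ((hA.comp (by fun_prop : Continuous fun r : ℝ => (r, θ))).continuousOn.integrableOn_compact
              isCompact_Icc) measurableSet_Ioi ?_)
          rintro r ⟨h1, h3⟩
          apply hA0
          by_contra! h
          exact h3 ⟨le_of_lt h1, h⟩
        · refine tendsto_const_nhds.congr' ?_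
          filter_upwards [eventually_gt_atTop R] with r hr
          exact (image_eq_zero_of_notMem_tsupport (hz0 r θ hr)).symm
      simp only [Prod.swap_prod_mk, key]
      rw [setIntegral_const]
      simp [Measure.real, Real.pi_pos.le]
      left; ring
    · exact iA.swap
  have intB : ∫ p in Ioi (0 : ℝ) ×ˢ Ioo (-Real.pi) Real.pi, B p = 0 := by
    rw [Measure.volume_eq_prod, setIntegral_prod _ iB]
    refine setIntegral_eq_zero_of_forall_eq_zero fun r hr => ?_
    have hr0 : (r : ℂ) ≠ 0 := by exact_mod_cast (ne_of_gt hr)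
    rw [← integral_Ioc_eq_integral_Ioo, ← intervalIntegral.integral_of_le (by linarith [Real.pi_pos])]
    have hd (θ : ℝ) : HasDerivAt (fun θ : ℝ => F (r * exp (θ * I)) / r) (B (r, θ)) θ := by
      have : HasDerivAt (fun θ : ℝ => (r * exp (θ * I) : ℂ)) (r • (I * exp (θ * I))) θ := by
        have := (((hasDerivAt_id θ).ofReal_comp.mul_const I).cexp).const_mul (r : ℂ)
        refine HasDerivAt.congr_deriv this ?_
        rw [real_smul]
        simp only [id, ofReal_one]
        ring
      have := ((hFd _).comp_hasDerivAt θ this).div_const (r : ℂ)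
      rw [map_smul, real_smul, mul_div_cancel_left₀ _ hr0] at this
      exact this
    rw [intervalIntegral.integral_eq_sub_of_hasDerivAt (fun θ _ => hd θ)
      ((hB.comp (by fun_prop : Continuous fun θ : ℝ => (r, θ))).intervalIntegrable _ _)]
    push_cast
    rw [neg_mul, exp_neg, exp_pi_mul_I]
    norm_num
  rw [← Complex.integral_comp_polarCoord_symm, polarCoord_target]
  have : ∀ p ∈ Ioi (0 : ℝ) ×ˢ Ioo (-Real.pi) Real.pi,
      p.1 • ((Complex.polarCoord.symm p)⁻¹ * dbar F (Complex.polarCoord.symm p)) =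
        A p + I * B p := by
    rintro ⟨r, θ⟩ ⟨hr, -⟩
    have hr0 : (r : ℂ) ≠ 0 := by exact_mod_cast (ne_of_gt hr)
    have h1 : Complex.polarCoord.symm (r, θ) = r * exp (θ * I) := by
      rw [Complex.polarCoord_symm_apply, exp_mul_I]; simp
    simp only [A, B, ← exp_neg_mul_dbar, h1, real_smul, mul_inv, exp_neg]
    field_simp
  rw [setIntegral_congr_fun (measurableSet_Ioi.prod measurableSet_Ioo) this,
    integral_add iA (iB.const_mul I), integral_const_mul, intA, intB]
  simp

lemma locallyIntegrable_inv : LocallyIntegrable (fun z : ℂ => z⁻¹) := by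
  refine locallyIntegrable_of_norm_le_rpow (C := 1) (α := 1) (by simp) (by simp) ?_ ?_
  · refine Eventually.of_forall fun z => ?_
    simp [Real.rpow_neg_one]
  · exact measurable_inv.aestronglyMeasurable

/-- The inhomogeneous Cauchy–Riemann equation with compactly supported right-hand side, solved by
convolution with the Cauchy kernel. -/
lemma exists_dbar_eq_of_hasCompactSupport {f : ℂ → ℂ} (hf : ContDiff ℝ (⊤ : ℕ∞) f)
    (hc : HasCompactSupport f) :
    ∃ v : ℂ → ℂ, ContDiff ℝ (⊤ : ℕ∞) v ∧ ∀ z, dbar v z = f z := by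
  let L := ContinuousLinearMap.mul ℝ ℂ
  let K : ℂ → ℂ := fun z => z⁻¹
  let v : ℂ → ℂ := convolution K f L volume
  have hf1 : ContDiff ℝ 1 f := hf.of_le (by exact_mod_cast le_top)
  have hv : ContDiff ℝ (⊤ : ℕ∞) v := hc.contDiff_convolution_right L locallyIntegrable_inv hf
  have hdv (z : ℂ) : dbar v z = 2 * Real.pi * f z := by
    have hd := hc.hasFDerivAt_convolution_right L (μ := volume) locallyIntegrable_inv hf1 z
    have hex : ConvolutionExistsAt K (fderiv ℝ f) z (L.precompR ℂ) volume :=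
      (hc.fderiv ℝ).convolutionExists_right _ locallyIntegrable_inv
        (hf1.continuous_fderiv one_ne_zero) z
    have hap (e : ℂ) : fderiv ℝ v z e = ∫ ζ, ζ⁻¹ * fderiv ℝ f (z - ζ) e := by
      rw [hd.fderiv]
      exact ContinuousLinearMap.integral_apply hex e
    have hin (e : ℂ) : Integrable fun ζ => ζ⁻¹ * fderiv ℝ f (z - ζ) e :=
      ContinuousLinearMap.integrable_comp (ContinuousLinearMap.apply ℝ ℂ e) hex
    have hF : ContDiff ℝ 1 fun ζ => f (z - ζ) := hf1.comp (by fun_prop)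
    have hFc : HasCompactSupport fun ζ => f (z - ζ) :=
      hc.comp_homeomorph (Homeomorph.subLeft z)
    have hdF (ζ : ℂ) : dbar (fun ζ => f (z - ζ)) ζ =
        -(fderiv ℝ f (z - ζ) 1 + I * fderiv ℝ f (z - ζ) I) := by
      have : fderiv ℝ (fun ζ => f (z - ζ)) ζ = - fderiv ℝ f (z - ζ) := by
        have := ((hf1.differentiable one_ne_zero (z - ζ)).hasFDerivAt).comp ζ
          ((hasFDerivAt_id ζ).const_sub z)
        refine (HasFDerivAt.fderiv this).trans ?_
        ext; simp
      simp only [dbar, this, neg_apply]; ring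
    have hP := integral_inv_mul_dbar hF hFc
    simp only [hdF, mul_neg, integral_neg, sub_zero] at hP
    rw [dbar, hap, hap, ← integral_const_mul, ← integral_add (hin 1) ((hin I).const_mul I),
      ← neg_inj, ← neg_mul, ← hP]
    congr 2 with ζ
    ring
  refine ⟨fun z => (2 * Real.pi : ℂ)⁻¹ * v z, contDiff_const.mul hv, fun z => ?_⟩
  have h := hdv z
  have : fderiv ℝ (fun z => (2 * Real.pi : ℂ)⁻¹ * v z) z = (2 * Real.pi : ℂ)⁻¹ • fderiv ℝ v z :=
    fderiv_const_mul (hv.differentiable (by simp) z) _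
  have hpi : (Real.pi : ℂ) ≠ 0 := by exact_mod_cast Real.pi_ne_zero
  simp only [dbar, this, smul_apply, smul_eq_mul] at h ⊢
  calc _ = (2 * Real.pi : ℂ)⁻¹ * (fderiv ℝ v z 1 + I * fderiv ℝ v z I) := by ring
    _ = f z := by rw [h]; field_simp

lemma exists_dbar_eq_on_ball {f : ℂ → ℂ} (hf : ContDiff ℝ (⊤ : ℕ∞) f) :
    ∃ v : ℂ → ℂ, ContDiff ℝ (⊤ : ℕ∞) v ∧ ∀ z, ‖z‖ < 1 → dbar v z = f z := by
  let χ : ContDiffBump (0 : ℂ) := ⟨1, 2, one_pos, one_lt_two⟩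
  obtain ⟨v, hv, h⟩ := exists_dbar_eq_of_hasCompactSupport (f := fun z => (χ z : ℂ) * f z)
    ((ofRealCLM.contDiff.comp χ.contDiff).mul hf)
    ((χ.hasCompactSupport.comp_left (g := ((↑) : ℝ → ℂ)) rfl).mul_right)
  refine ⟨v, hv, fun z hz => ?_⟩
  rw [h, χ.one_of_mem_closedBall (by simpa [χ] using hz.le)]
  simp

/-- A smooth function all of whose derivatives are bounded. -/
def HasBoundedDerivs {E F : Type*} [NormedAddCommGroup E] [NormedSpace ℝ E]
    [NormedAddCommGroup F] [NormedSpace ℝ F] (f : E → F) : Prop :=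
  ContDiff ℝ (⊤ : ℕ∞) f ∧ ∀ n : ℕ, ∃ C, ∀ x, ‖iteratedFDeriv ℝ n f x‖ ≤ C

lemma HasBoundedDerivs.comp_clm {E E' F : Type*} [NormedAddCommGroup E] [NormedSpace ℝ E]
    [NormedAddCommGroup E'] [NormedSpace ℝ E'] [NormedAddCommGroup F] [NormedSpace ℝ F]
    {f : E → F} (hf : HasBoundedDerivs f) (L : E' →L[ℝ] E) :
    HasBoundedDerivs (fun x => f (L x)) := by
  refine ⟨hf.1.comp L.contDiff, fun n => ?_⟩
  obtain ⟨C, hC⟩ := hf.2 n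
  refine ⟨C * ‖L‖ ^ n, fun x => ?_⟩
  have := L.iteratedFDeriv_comp_right hf.1 x (i := n) (by exact_mod_cast le_top)
  rw [Function.comp_def] at this
  rw [this]
  refine (ContinuousMultilinearMap.norm_compContinuousLinearMap_le _ _).trans ?_
  simp only [Finset.prod_const, Finset.card_fin]
  gcongr
  exact hC _

lemma HasBoundedDerivs.mul {E : Type*} [NormedAddCommGroup E] [NormedSpace ℝ E]
    {f g : E → ℂ} (hf : HasBoundedDerivs f) (hg : HasBoundedDerivs g) :
    HasBoundedDerivs (fun x => f x * g x) := by
  refine ⟨hf.1.mul hg.1, fun n => ?_⟩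
  choose C hC using hf.2
  choose D hD using hg.2
  refine ⟨∑ i ∈ Finset.range (n + 1), (n.choose i : ℝ) * C i * D (n - i), fun x => ?_⟩
  refine (norm_iteratedFDeriv_mul_le hf.1 hg.1 x (by exact_mod_cast le_top)).trans ?_
  gcongr with i
  · exact mul_nonneg (Nat.cast_nonneg _) ((norm_nonneg _).trans (hC i x))
  · exact hC i x
  · exact hD _ x

lemma hasBoundedDerivs_exp_mul_I : HasBoundedDerivs (fun x : ℝ => exp (x * I)) := by
  have h (n : ℕ) : iteratedDeriv n (fun x : ℝ => exp (x * I)) = fun x : ℝ => I ^ n * exp (x * I) := by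
    induction n with
    | zero => simp
    | succ n ih =>
      ext x
      rw [iteratedDeriv_succ, ih]
      have := ((((hasDerivAt_id x).ofReal_comp.mul_const I).cexp).const_mul (I ^ n)).deriv
      refine Eq.trans this ?_
      simp only [id, ofReal_one]; ring
  refine ⟨(ofRealCLM.contDiff.mul contDiff_const).cexp, fun n => ⟨1, fun x => ?_⟩⟩
  rw [norm_iteratedFDeriv_eq_norm_iteratedDeriv, h]
  simp [norm_exp_ofReal_mul_I]

lemma exists_hasBoundedDerivs_eq_exp_neg :
    ∃ φ : ℝ → ℂ, HasBoundedDerivs φ ∧ ∀ t, 0 ≤ t → φ t = exp (-t) := by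
  let φ : ℝ → ℂ := fun t => ((Real.smoothTransition (t + 1) : ℝ) : ℂ) * exp (-t)
  have hφ : ContDiff ℝ (⊤ : ℕ∞) φ := by
    refine ContDiff.mul (ofRealCLM.contDiff.comp
      (Real.smoothTransition.contDiff.comp (by fun_prop))) ofRealCLM.contDiff.neg.cexp
  have hpos (t : ℝ) (ht : 0 ≤ t) : φ t = exp (-t) := by
    simp [φ, Real.smoothTransition.one_of_one_le (by linarith : 1 ≤ t + 1)]
  refine ⟨φ, ⟨hφ, fun n => ?_⟩, hpos⟩
  have h (n : ℕ) : iteratedDeriv n (fun x : ℝ => exp (-x)) = fun x : ℝ => (-1) ^ n * exp (-x) := by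
    induction n with
    | zero => simp
    | succ n ih =>
      ext x
      rw [iteratedDeriv_succ, ih]
      have := (((hasDerivAt_id x).ofReal_comp.neg.cexp).const_mul ((-1) ^ n)).deriv
      refine Eq.trans this ?_
      simp only [id, ofReal_one, Pi.neg_apply]; ring
  obtain ⟨C, hC⟩ := isCompact_Icc.exists_bound_of_continuousOn (s := Icc (-1 : ℝ) 0)
    (hφ.continuous_iteratedFDeriv (m := n) (by exact_mod_cast le_top)).continuousOn
  refine ⟨max C 1, fun t => ?_⟩
  rcases lt_or_ge 0 t with ht | ht
  · have : φ =ᶠ[𝓝 t] fun x : ℝ => exp (-x) := by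
      filter_upwards [lt_mem_nhds ht] with s hs using hpos s hs.le
    rw [norm_iteratedFDeriv_eq_norm_iteratedDeriv, this.iteratedDeriv_eq, h, norm_mul, norm_pow,
      norm_neg, norm_one, one_pow, one_mul, ← ofReal_neg, norm_exp_ofReal]
    exact le_max_of_le_right (Real.exp_le_one_iff.2 (by linarith))
  rcases lt_or_ge t (-1) with ht' | ht'
  · have : φ =ᶠ[𝓝 t] fun x : ℝ => 0 := by
      filter_upwards [gt_mem_nhds ht'] with s hs
      simp [φ, Real.smoothTransition.zero_of_nonpos (by linarith : s + 1 ≤ 0)]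
    rw [norm_iteratedFDeriv_eq_norm_iteratedDeriv, this.iteratedDeriv_eq, iteratedDeriv_const]
    split_ifs <;> simp
  · exact le_max_of_le_left (hC t ⟨ht', ht⟩)

/-- A smooth `2π`-periodic function with bounded derivatives that equals `exp (i w)` on the upper
half plane. -/
lemma exists_hasBoundedDerivs_eq_exp_mul_I :
    ∃ Φ : ℂ → ℂ, HasBoundedDerivs Φ ∧ (∀ w, 0 ≤ w.im → Φ w = exp (w * I)) ∧
      ∀ w (m : ℤ), Φ (w + m * (2 * Real.pi)) = Φ w := by
  obtain ⟨φ, hφ, h⟩ := exists_hasBoundedDerivs_eq_exp_neg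
  refine ⟨fun w => exp (w.re * I) * φ w.im,
    (hasBoundedDerivs_exp_mul_I.comp_clm reCLM).mul (hφ.comp_clm imCLM), fun w hw => ?_,
    fun w m => ?_⟩
  · simp only [h _ hw]
    rw [← Complex.exp_add]
    congr 1
    conv_rhs => rw [← re_add_im w]
    linear_combination (-w.im : ℂ) * I_mul_I
  · have h1 : (w + m * (2 * Real.pi)).im = w.im := by simp
    have h2 : (w + m * (2 * Real.pi)).re = w.re + m * (2 * Real.pi) := by simp
    simp only [h1, h2]
    congr 1
    rw [exp_eq_exp_iff_exists_int]
    exact ⟨m, by push_cast; ring⟩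

lemma exists_bound_fourierCoeffOn (n : ℕ) : ∀ (h : ℝ → ℂ), ContDiff ℝ (⊤ : ℕ∞) h →
    Function.Periodic h (2 * Real.pi) →
    ∃ C, ∀ k : ℤ, k ≠ 0 → ‖fourierCoeffOn Real.two_pi_pos h k‖ ≤ C / |(k : ℝ)| ^ n := by
  induction n with
  | zero =>
    intro h hh _
    obtain ⟨C, hC⟩ := isCompact_Icc.exists_bound_of_continuousOn (s := Icc 0 (2 * Real.pi))
      hh.continuous.continuousOn
    refine ⟨C, fun k _ => ?_⟩
    rw [fourierCoeffOn_eq_integral, norm_smul, pow_zero, div_one]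
    have := intervalIntegral.norm_integral_le_of_norm_le_const (a := 0) (b := 2 * Real.pi) (C := C)
      (f := fun x => fourier (-k) (x : AddCircle (2 * Real.pi - 0)) • h x) (fun x hx => by
        rw [uIoc_of_le Real.two_pi_pos.le] at hx
        rw [norm_smul, fourier_apply, Circle.norm_coe, one_mul]
        exact hC x (Ioc_subset_Icc_self hx))
    have h2 : |2 * Real.pi - 0| = 2 * Real.pi := by rw [sub_zero, abs_of_pos Real.two_pi_pos]
    rw [h2] at this
    calc _ ≤ ‖1 / (2 * Real.pi - 0)‖ * (C * (2 * Real.pi)) := by gcongr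
      _ = C := by
        rw [sub_zero, Real.norm_of_nonneg (by positivity)]
        field_simp
  | succ n ih =>
    intro h hh hp
    have hd : ContDiff ℝ (⊤ : ℕ∞) (deriv h) := (contDiff_infty_iff_deriv.1 hh).2
    obtain ⟨C, hC⟩ := ih (deriv h) hd fun x => by
      rw [← deriv_comp_add_const]
      congr 1
      ext y
      exact hp y
    refine ⟨C, fun k hk => ?_⟩
    have hk' : (k : ℝ) ≠ 0 := by exact_mod_cast hk
    rw [fourierCoeffOn_of_hasDerivAt Real.two_pi_pos hk
      (fun x _ => (hh.differentiable (by simp) x).hasDerivAt)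
      (hd.continuous.intervalIntegrable _ _)]
    have h0 : h (2 * Real.pi) = h 0 := by simpa using hp 0
    rw [h0, sub_self, mul_zero, zero_sub, mul_neg, norm_neg, norm_mul, norm_mul]
    have e1 : ‖1 / (-2 * (Real.pi : ℂ) * I * k)‖ = 1 / (2 * Real.pi * |(k : ℝ)|) := by
      simp [abs_of_pos Real.pi_pos]
    have e2 : ‖(((2 * Real.pi : ℝ) : ℂ) - ((0 : ℝ) : ℂ))‖ = 2 * Real.pi := by
      simp [abs_of_pos Real.pi_pos]
    rw [e1, e2]
    calc _ ≤ 1 / (2 * Real.pi * |(k : ℝ)|) * (2 * Real.pi * (C / |(k : ℝ)| ^ n)) := by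
          gcongr; exact hC k hk
      _ = _ := by
        have := abs_pos.2 hk'
        field_simp
        ring

/-- Smooth periodic functions are the sums of their rapidly decreasing Fourier series. -/
lemma exists_rapidDecay_hasSum {h : ℝ → ℂ} (hh : ContDiff ℝ (⊤ : ℕ∞) h)
    (hp : Function.Periodic h (2 * Real.pi)) :
    ∃ c : ℤ → ℂ, (∀ n : ℕ, ∃ C, ∀ k : ℤ, k ≠ 0 → ‖c k‖ ≤ C / |(k : ℝ)| ^ n) ∧
      ∀ θ ∈ Ioc 0 (2 * Real.pi), HasSum (fun k : ℤ => c k * exp (θ * I) ^ k) (h θ) := by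
  have hdecay (n : ℕ) := exists_bound_fourierCoeffOn n h hh hp
  refine ⟨fourierCoeffOn Real.two_pi_pos h, hdecay, fun θ hθ => ?_⟩
  have : Fact (0 < 2 * Real.pi - 0) := ⟨by simpa using Real.two_pi_pos⟩
  let f : C(AddCircle (2 * Real.pi - 0), ℂ) :=
    ⟨AddCircle.liftIoc (2 * Real.pi - 0) 0 h,
      AddCircle.liftIoc_continuous (by simpa using (hp 0).symm) hh.continuous.continuousOn⟩
  have hs : Summable (fourierCoeff f) := by
    obtain ⟨C, hC⟩ := hdecay 2
    refine Summable.of_norm_bounded_eventually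
      ((Real.summable_one_div_int_pow (p := 2)).2 one_lt_two |>.mul_left C) ?_
    have : ∀ᶠ k : ℤ in cofinite, k ≠ 0 := eventually_cofinite_ne 0
    filter_upwards [this] with k hk
    refine (hC k hk).trans_eq ?_
    rw [sq_abs]; ring
  have key := has_pointwise_sum_fourier_series_of_summable hs (θ : AddCircle (2 * Real.pi - 0))
  have hfθ : f (θ : AddCircle (2 * Real.pi - 0)) = h θ :=
    AddCircle.liftIoc_coe_apply (by simpa using hθ)
  rw [hfθ] at key
  refine key.congr_fun fun k => ?_
  rw [fourier_coe_apply, smul_eq_mul, ← Complex.exp_int_mul]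
  have hpi : (Real.pi : ℂ) ≠ 0 := by exact_mod_cast Real.pi_ne_zero
  congr 2
  push_cast
  field_simp
  ring

lemma dbar_eq_zero_of_differentiableAt {f : ℂ → ℂ} {z : ℂ} (hf : DifferentiableAt ℂ f z) :
    dbar f z = 0 := by
  have h (e : ℂ) : fderiv ℝ f z e = e * deriv f z := by
    rw [hf.fderiv_restrictScalars ℝ]
    simp [fderiv_eq_smul_deriv]
  rw [dbar, h, h]
  linear_combination (deriv f z) * I_mul_I

/-- A power series with rapidly decreasing coefficients is holomorphic on the open unit disc, and
its restriction to the closed disc extends smoothly to the plane. -/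
lemma exists_contDiff_extension {a : ℕ → ℂ}
    (ha : ∀ n : ℕ, ∃ C, ∀ k : ℕ, k ≠ 0 → ‖a k‖ ≤ C / (k : ℝ) ^ n) :
    ∃ H : ℂ → ℂ, ContDiff ℝ (⊤ : ℕ∞) H ∧ (∀ z, ‖z‖ < 1 → dbar H z = 0) ∧
      ∀ z, ‖z‖ = 1 → HasSum (fun k => a k * z ^ k) (H z) := by
  have hsum (n : ℕ) : Summable fun k => ‖a k‖ * (k : ℝ) ^ n := by
    obtain ⟨C, hC⟩ := ha (n + 2)
    refine Summable.of_norm_bounded_eventually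
      ((Real.summable_one_div_nat_pow (p := 2)).2 one_lt_two |>.mul_left C) ?_
    filter_upwards [eventually_cofinite_ne 0] with k hk
    have hk' : (0 : ℝ) < k := by exact_mod_cast Nat.pos_of_ne_zero hk
    rw [Real.norm_of_nonneg (by positivity)]
    calc _ ≤ C / (k : ℝ) ^ (n + 2) * (k : ℝ) ^ n := by gcongr; exact hC k hk
      _ = _ := by field_simp; ring
  have hsum0 : Summable fun k => ‖a k‖ := by simpa using hsum 0
  obtain ⟨Φ, ⟨hΦ, hΦb⟩, hΦexp, hΦper⟩ := exists_hasBoundedDerivs_eq_exp_mul_I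
  choose B hB using hΦb
  let P : ℂ → ℂ := fun z => ∑' k, a k * z ^ k
  let G : ℂ → ℂ := fun w => ∑' k : ℕ, a k * Φ ((k : ℝ) • w)
  have hterm (k : ℕ) : ContDiff ℝ (⊤ : ℕ∞) fun w => Φ ((k : ℝ) • w) :=
    hΦ.comp (contDiff_const_smul _)
  have hG : ContDiff ℝ (⊤ : ℕ∞) G := by
    refine contDiff_tsum (v := fun n k => B n * (‖a k‖ * (k : ℝ) ^ n))
      (fun k => contDiff_const.mul (hterm k))
      (fun n _ => (hsum n).mul_left _) fun n k w _ => ?_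
    have h1 : iteratedFDeriv ℝ n (fun w => a k • Φ ((k : ℝ) • w)) w =
        a k • iteratedFDeriv ℝ n (fun w => Φ ((k : ℝ) • w)) w :=
      iteratedFDeriv_const_smul_apply' ((hterm k).of_le (by exact_mod_cast le_top)).contDiffAt
    simp only [smul_eq_mul] at h1
    rw [h1, iteratedFDeriv_comp_const_smul _ (hΦ.of_le (by exact_mod_cast le_top)), norm_smul,
      norm_smul, norm_pow, Real.norm_natCast]
    calc _ ≤ ‖a k‖ * ((k : ℝ) ^ n * B n) := by gcongr; exact hB n _
      _ = _ := by ring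
  have hGper (w : ℂ) (m : ℤ) : G (w + m * (2 * Real.pi)) = G w := by
    refine tsum_congr fun k => ?_
    rw [← hΦper ((k : ℝ) • w) (k * m)]
    congr 2
    simp only [real_smul]
    push_cast
    ring
  have hGP (w : ℂ) (hw : 0 ≤ w.im) : G w = P (exp (w * I)) := by
    refine tsum_congr fun k => ?_
    rw [hΦexp _ (by simp; positivity), ← Complex.exp_nat_mul]
    congr 2
    simp only [real_smul]
    push_cast
    ring
  have hPd : DifferentiableOn ℂ P (Metric.ball 0 1) := by
    refine differentiableOn_tsum_of_summable_norm hsum0 (fun k => by fun_prop)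
      Metric.isOpen_ball fun k z hz => ?_
    rw [norm_mul, norm_pow]
    exact mul_le_of_le_one_right (norm_nonneg _)
      (pow_le_one₀ (norm_nonneg _) (by simpa using (mem_ball_zero_iff.1 hz).le))
  let H : ℂ → ℂ := fun z => if ‖z‖ < 1 then P z else G (log z * -I)
  have hHball : EqOn H P (Metric.ball 0 1) := fun z hz => if_pos (mem_ball_zero_iff.1 hz)
  have hHexp (w : ℂ) : H (exp (w * I)) = G w := by
    by_cases hw : ‖exp (w * I)‖ < 1
    · simp only [H, if_pos hw]
      refine (hGP w ?_).symm
      rw [norm_exp] at hw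
      simp at hw
      exact hw.le
    · simp only [H, if_neg hw]
      obtain ⟨m, hm⟩ := exp_eq_exp_iff_exists_int.1 (exp_log (exp_ne_zero (w * I)))
      rw [hm, ← hGper w m]
      congr 1
      linear_combination (-w - m * (2 * Real.pi)) * I_mul_I
  have hev (z : ℂ) (hz : ‖z‖ < 1) : H =ᶠ[𝓝 z] P :=
    hHball.eventuallyEq_of_mem (Metric.isOpen_ball.mem_nhds (mem_ball_zero_iff.2 hz))
  have hPat (z : ℂ) (hz : ‖z‖ < 1) : AnalyticAt ℂ P z :=
    hPd.analyticAt (Metric.isOpen_ball.mem_nhds (mem_ball_zero_iff.2 hz))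
  refine ⟨H, contDiff_iff_contDiffAt.2 fun z => ?_, fun z hz => ?_, fun z hz => ?_⟩
  · rcases eq_or_ne z 0 with rfl | hz
    · exact ((hPat 0 (by simp)).contDiffAt.restrict_scalars ℝ).congr_of_eventuallyEq
        (hev 0 (by simp))
    · have hloc : H =ᶠ[𝓝 z] fun y => G ((log z + log (y / z)) * -I) := by
        filter_upwards [isOpen_ne.mem_nhds hz] with y hy
        rw [← hHexp]
        congr 1
        have : (log z + log (y / z)) * -I * I = log z + log (y / z) := by
          linear_combination (-(log z + log (y / z))) * I_mul_I
        rw [this, Complex.exp_add, exp_log hz, exp_log (div_ne_zero hy hz)]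
        field_simp
      refine ContDiffAt.congr_of_eventuallyEq ?_ hloc
      have hlog : ContDiffAt ℝ (⊤ : ℕ∞) (fun y => log (y / z)) z := by
        refine ContDiffAt.restrict_scalars ℝ ?_ (𝕜' := ℂ)
        exact (contDiffAt_log (by simp [hz])).comp z (contDiffAt_id.div_const z)
      exact hG.contDiffAt.comp z ((contDiffAt_const.add hlog).mul contDiffAt_const)
  · have := dbar_eq_zero_of_differentiableAt (hPat z hz).differentiableAt
    rwa [dbar, ← (hev z hz).fderiv_eq] at this
  · have hz0 : z ≠ 0 := by rintro rfl; simp at hz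
    have hexp : exp (log z * -I * I) = z := by
      rw [mul_assoc, neg_mul, I_mul_I, neg_neg, mul_one, exp_log hz0]
    have hHz : H z = P z := by
      conv_lhs => rw [← hexp]
      rw [hHexp, hGP _ (by simp [log_re, hz]), hexp]
    rw [hHz]
    refine (Summable.of_norm ?_).hasSum
    simpa [hz] using hsum0

/-- The Dirichlet problem for the real part of a holomorphic function on the disc. -/
lemma exists_dbar_eq_zero_re_eq {g : ℂ → ℝ} (hg : ContDiff ℝ (⊤ : ℕ∞) g) :
    ∃ H : ℂ → ℂ, ContDiff ℝ (⊤ : ℕ∞) H ∧ (∀ z, ‖z‖ < 1 → dbar H z = 0) ∧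
      ∀ z, ‖z‖ = 1 → (H z).re = g z := by
  let h : ℝ → ℂ := fun θ => g (exp (θ * I))
  have hh : ContDiff ℝ (⊤ : ℕ∞) h :=
    ofRealCLM.contDiff.comp (hg.comp (ofRealCLM.contDiff.mul contDiff_const).cexp)
  have hp : Function.Periodic h (2 * Real.pi) := fun θ => by
    have : exp (((θ + 2 * Real.pi : ℝ) : ℂ) * I) = exp (θ * I) := by
      rw [exp_eq_exp_iff_exists_int]
      exact ⟨1, by push_cast; ring⟩
    simp only [h, this]
  obtain ⟨c, hc, hsum⟩ := exists_rapidDecay_hasSum hh hp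
  obtain ⟨H, hH, hd, hb⟩ := exists_contDiff_extension
    (a := fun k : ℕ => c k + (starRingEnd ℂ) (c (-k))) fun n => by
      obtain ⟨C, hC⟩ := hc n
      refine ⟨2 * C, fun k hk => ?_⟩
      have h1 := hC k (by exact_mod_cast hk)
      have h2 := hC (-k) (by simpa using hk)
      simp only [Int.cast_natCast, Int.cast_neg, abs_neg, Nat.abs_cast] at h1 h2
      calc _ ≤ ‖c k‖ + ‖c (-k)‖ := (norm_add_le _ _).trans_eq (by rw [RCLike.norm_conj])
        _ ≤ _ := by rw [mul_div_assoc, two_mul]; exact add_le_add h1 h2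
  refine ⟨fun z => H z - c 0, hH.sub contDiff_const, fun z hz => ?_, fun z hz => ?_⟩
  · rw [← hd z hz, dbar, dbar, fderiv_sub_const]
  · obtain ⟨θ, hθ, rfl⟩ : ∃ θ ∈ Ioc 0 (2 * Real.pi), exp (θ * I) = z := by
      have hz' : exp (arg z * I) = z := by
        simpa [hz] using norm_mul_exp_arg_mul_I z
      rcases lt_or_ge 0 (arg z) with h0 | h0
      · exact ⟨arg z, ⟨h0, by linarith [arg_le_pi z, Real.pi_pos]⟩, hz'⟩
      · refine ⟨arg z + 2 * Real.pi, ⟨by linarith [neg_pi_lt_arg z, Real.pi_pos], by linarith⟩, ?_⟩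
        rw [← hz', exp_eq_exp_iff_exists_int]
        exact ⟨1, by push_cast; rw [hz']; ring⟩
    have h1 := Complex.hasSum_re (hsum θ hθ).nat_add_neg
    have h2 := Complex.hasSum_re (hb _ hz)
    have h3 : (H (exp (θ * I))).re = (h θ + c 0).re := by
      refine h2.unique ?_
      convert h1 using 1
      · ext k
        have hconj : (starRingEnd ℂ) (exp (θ * I)) = (exp (θ * I))⁻¹ := by
          rw [← exp_conj, ← exp_neg]; simp
        have : (starRingEnd ℂ) (c (-k) * exp (θ * I) ^ (-(k : ℤ))) =
            (starRingEnd ℂ) (c (-k)) * exp (θ * I) ^ k := by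
          rw [map_mul, map_zpow₀, hconj, inv_zpow', neg_neg, zpow_natCast]
        rw [add_mul, add_re, add_re, ← this, conj_re, zpow_natCast]
      · simp
    simp [h3, h]

/-- Scalar Cauchy–Riemann problem on the disc with boundary values in the real line `i p(z) ℝ`, for
a holomorphic `p` that is unimodular on the circle. -/
lemma exists_dbar_eq_mem_real_line {f : ℂ → ℂ} (hf : ContDiff ℝ (⊤ : ℕ∞) f) {p : ℂ → ℂ}
    (hp : ContDiff ℝ (⊤ : ℕ∞) p) (hpd : Differentiable ℂ p) (hp1 : ∀ z, ‖z‖ = 1 → ‖p z‖ = 1) :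
    ∃ u : ℂ → ℂ, ContDiff ℝ (⊤ : ℕ∞) u ∧ (∀ z, ‖z‖ < 1 → dbar u z = f z) ∧
      ∀ z, ‖z‖ = 1 → ∃ t : ℝ, u z = I * p z * t := by
  obtain ⟨v, hv, hvd⟩ := exists_dbar_eq_on_ball hf
  obtain ⟨H, hH, hHd, hHb⟩ := exists_dbar_eq_zero_re_eq
    (g := fun z => ((starRingEnd ℂ) (p z) * v z).re)
    (reCLM.contDiff.comp ((conjCLE.contDiff.comp hp).mul hv))
  refine ⟨fun z => v z - p z * H z, hv.sub (hp.mul hH), fun z hz => ?_, fun z hz => ?_⟩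
  · have dv := (hv.differentiable (by simp) z).hasFDerivAt
    have dH := (hH.differentiable (by simp) z).hasFDerivAt
    have dp := (hp.differentiable (by simp) z).hasFDerivAt
    have h1 : fderiv ℝ (fun z => v z - p z * H z) z = _ := (dv.sub (dp.mul dH)).fderiv
    have h2 := hHd z hz
    have h3 := dbar_eq_zero_of_differentiableAt (hpd z)
    rw [← hvd z hz]
    simp only [dbar, h1] at h2 h3 ⊢
    simp
    linear_combination (-p z) * h2 - H z * h3
  · have hpp : (starRingEnd ℂ) (p z) * p z = 1 := by
      rw [conj_mul', hp1 z hz]; simp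
    refine ⟨((starRingEnd ℂ) (p z) * v z - H z).im, ?_⟩
    have h4 : (starRingEnd ℂ) (p z) * v z - H z =
        I * (((starRingEnd ℂ) (p z) * v z - H z).im : ℝ) := by
      apply Complex.ext
      · rw [sub_re, hHb z hz]; simp
      · simp
    calc v z - p z * H z = p z * ((starRingEnd ℂ) (p z) * v z - H z) := by
          linear_combination (-v z) * hpp
      _ = _ := by rw [h4]; simp; ring

/-- Proposition 2.1 (surjectivity, smooth category): for every smooth
`w : ℂ → ℂ × ℂⁿ` there is a smooth `u : ℂ → ℂ × ℂⁿ` solving the Cauchy–Riemann equation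
`∂ₓu + i ∂_y u = w` on the open unit disc with totally real boundary condition
`u z ∈ i z ℝ × ℝⁿ` for `|z| = 1`. -/
theorem CR_operator_surjective (n : ℕ) (w : ℂ → ℂ × (Fin n → ℂ))
    (hw : ContDiff ℝ (⊤ : ℕ∞) w) :
    ∃ u : ℂ → ℂ × (Fin n → ℂ), ContDiff ℝ (⊤ : ℕ∞) u ∧
      (∀ z : ℂ, ‖z‖ < 1 →
        fderiv ℝ u z 1 + Complex.I • fderiv ℝ u z Complex.I = w z) ∧
      ∀ z : ℂ, ‖z‖ = 1 →
        (∃ t : ℝ, (u z).1 = Complex.I * z * (t : ℂ)) ∧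
        ∀ k, ∃ r : ℝ, (u z).2 k = (r : ℂ) := by
  have hw2 (k : Fin n) : ContDiff ℝ (⊤ : ℕ∞) fun z => (w z).2 k :=
    contDiff_pi.1 (contDiff_snd.comp hw) k
  obtain ⟨a, ha, had, hab⟩ := exists_dbar_eq_mem_real_line (contDiff_fst.comp hw) (p := id)
    contDiff_id differentiable_id fun _ h => h
  choose b hb hbd hbb using fun k => exists_dbar_eq_mem_real_line (hw2 k) (p := fun _ => -I)
    contDiff_const (differentiable_const _) (by simp)
  refine ⟨fun z => (a z, fun k => b k z), ha.prodMk (contDiff_pi.2 hb), fun z hz => ?_,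
    fun z hz => ⟨hab z hz, fun k => ?_⟩⟩
  · have h : fderiv ℝ (fun z => (a z, fun k => b k z)) z = _ :=
      ((ha.differentiable (by simp) z).hasFDerivAt.prodMk
        (hasFDerivAt_pi.2 fun k => ((hb k).differentiable (by simp) z).hasFDerivAt)).fderiv
    rw [h]
    refine Prod.ext (had z hz) (funext fun k => hbd k z hz)
  · obtain ⟨t, ht⟩ := hbb k z hz
    exact ⟨t, ht.trans (by simp)⟩
end

section
/- Let N ∈ ℕ and let f : ℂ → ℂ^N be continuously differentiable (in the real sense) on an open neighborhood of the closed unit disc D and holomorphic (each component complex differentiable) at every point of the open unit disc. Then 4π ∫_{|z|<1} ‖f'‖² dA ≤ (∫₀^{2π} ‖f'(e^{iθ})‖ dθ)², i.e. the area of the holomorphic disc is at most 1/(4π) times the square of the length of its boundary curve. -/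
open MeasureTheory Filter Topology

open Polynomial in
theorem Polynomial.sum_sq_norm_coeff_mul_div_le (P Q : ℂ[X]) :
    ∑ n ∈ (P * Q).support, ‖(P * Q).coeff n‖ ^ 2 / (n + 1) ≤
      (∑ i ∈ P.support, ‖P.coeff i‖ ^ 2) * ∑ j ∈ Q.support, ‖Q.coeff j‖ ^ 2 := by
  have key (R : ℂ[X]) : HasSum (fun i ↦ ‖R.coeff i‖ ^ 2) (∑ i ∈ R.support, ‖R.coeff i‖ ^ 2) :=
    hasSum_sum_of_ne_finset_zero fun i hi ↦ by simpa using hi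
  have hP := (key P).summable.norm
  have hQ := (key Q).summable.norm
  rw [← (key P).tsum_eq, ← (key Q).tsum_eq,
    tsum_mul_tsum_eq_tsum_sum_antidiagonal_of_summable_norm hP hQ]
  have hs := (summable_norm_sum_mul_antidiagonal_of_summable_norm hP hQ).of_norm
  refine le_trans (Finset.sum_le_sum fun n _ ↦ ?_)
    (hs.sum_le_tsum (P * Q).support fun n _ ↦ Finset.sum_nonneg fun _ _ ↦ by positivity)
  rw [div_le_iff₀ (by positivity), coeff_mul]
  calc ‖∑ x ∈ Finset.HasAntidiagonal.antidiagonal n, P.coeff x.1 * Q.coeff x.2‖ ^ 2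
      ≤ (∑ x ∈ Finset.HasAntidiagonal.antidiagonal n, ‖P.coeff x.1 * Q.coeff x.2‖) ^ 2 := by
        gcongr
        exact norm_sum_le _ _
    _ ≤ (Finset.HasAntidiagonal.antidiagonal n).card *
          ∑ x ∈ Finset.HasAntidiagonal.antidiagonal n, ‖P.coeff x.1 * Q.coeff x.2‖ ^ 2 := sq_sum_le_card_mul_sum_sq
    _ = _ := by
        rw [Finset.Nat.card_antidiagonal, mul_comm]
        push_cast
        simp only [norm_mul, mul_pow]

/-- Integration over the unit disc in polar coordinates. -/
theorem setIntegral_ball_eq_integral_circleAverage {F : ℂ → ℝ} (hF : Continuous F) :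
    ∫ z in Metric.ball (0 : ℂ) 1, F z =
      ∫ r in (0 : ℝ)..1, r * (2 * Real.pi * Real.circleAverage F 0 r) := by
  have hpi := Real.pi_pos
  rw [← integral_indicator Metric.isOpen_ball.measurableSet,
    ← Complex.integral_comp_polarCoord_symm, show polarCoord.target =
      Set.Ioi (0 : ℝ) ×ˢ Set.Ioo (-Real.pi) Real.pi from rfl]
  have hsub : Set.Ioo (0 : ℝ) 1 ×ˢ Set.Ioo (-Real.pi) Real.pi ⊆
      Set.Ioi (0 : ℝ) ×ˢ Set.Ioo (-Real.pi) Real.pi :=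
    Set.prod_mono (fun x hx ↦ hx.1) subset_rfl
  have hcirc (p : ℝ × ℝ) : Complex.polarCoord.symm p = circleMap 0 p.1 p.2 := by
    rw [Complex.polarCoord_symm_apply, circleMap, Complex.exp_mul_I]
    simp
  have hcont : Continuous fun p : ℝ × ℝ ↦ p.1 * F (circleMap 0 p.1 p.2) := by
    unfold circleMap
    fun_prop
  rw [setIntegral_eq_of_subset_of_forall_sdiff_eq_zero (s := Set.Ioo (0 : ℝ) 1 ×ˢ
    Set.Ioo (-Real.pi) Real.pi) (measurableSet_Ioi.prod measurableSet_Ioo) hsub]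
  · have heq : ∀ p ∈ Set.Ioo (0 : ℝ) 1 ×ˢ Set.Ioo (-Real.pi) Real.pi,
        p.1 • (Metric.ball (0 : ℂ) 1).indicator F (Complex.polarCoord.symm p) =
          p.1 * F (circleMap 0 p.1 p.2) := by
      intro p hp
      rw [hcirc, Set.indicator_of_mem, smul_eq_mul]
      simpa [abs_of_pos hp.1.1] using hp.1.2
    rw [setIntegral_congr_fun (measurableSet_Ioo.prod measurableSet_Ioo) heq,
      Measure.volume_eq_prod, setIntegral_prod, intervalIntegral.integral_of_le zero_le_one,
      integral_Ioc_eq_integral_Ioo]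
    · refine setIntegral_congr_fun measurableSet_Ioo fun r _ ↦ ?_
      simp only
      rw [integral_const_mul, Real.circleAverage_eq_integral_add (-Real.pi),
        intervalIntegral.integral_comp_add_right (fun θ ↦ F (circleMap 0 r θ)), smul_eq_mul,
        mul_inv_cancel_left₀ (by positivity), zero_add,
        show 2 * Real.pi + -Real.pi = Real.pi by ring,
        intervalIntegral.integral_of_le (by linarith), integral_Ioc_eq_integral_Ioo]
    · refine (hcont.continuousOn.integrableOn_compact
        (isCompact_Icc (a := (0 : ℝ)) (b := 1) |>.prod
          (isCompact_Icc (a := -Real.pi) (b := Real.pi)))).mono_set ?_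
      exact Set.prod_mono Set.Ioo_subset_Icc_self Set.Ioo_subset_Icc_self
  · rintro p ⟨⟨hp0, hpθ⟩, hp⟩
    rw [hcirc, Set.indicator_of_notMem, smul_zero]
    intro h
    refine hp ⟨⟨hp0, ?_⟩, hpθ⟩
    simpa [abs_of_pos (show 0 < p.1 from hp0)] using h

open Polynomial in
theorem Polynomial.circleAverage_sq_norm_eval (P : ℂ[X]) (r : ℝ) :
    Real.circleAverage (fun z ↦ ‖P.eval z‖ ^ 2) 0 r =
      ∑ n ∈ P.support, ‖P.coeff n‖ ^ 2 * r ^ (2 * n) := by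
  have h := (P.comp (C (r : ℂ) * X)).sum_sq_norm_coeff_eq_circleAverage
  rw [Real.circleAverage_eq_circleAverage_zero_one]
  simp only [eval_comp, eval_mul, eval_C, eval_X, comp_C_mul_X_coeff] at h
  simp only [add_zero]
  rw [← h]
  refine (Finset.sum_subset (fun n hn ↦ ?_) fun n _ hn ↦ ?_).trans
    (Finset.sum_congr rfl fun n _ ↦ ?_)
  · simp only [mem_support_iff, comp_C_mul_X_coeff] at hn ⊢
    exact left_ne_zero_of_mul hn
  · simp only [mem_support_iff, comp_C_mul_X_coeff, not_not] at hn
    simp [hn]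
  · rw [norm_mul, norm_pow, Complex.norm_real, mul_pow, ← pow_mul, mul_comm n 2, pow_mul,
      Real.norm_eq_abs, sq_abs, pow_mul]

open Polynomial in
theorem Polynomial.setIntegral_ball_sq_norm_eval (P : ℂ[X]) :
    ∫ z in Metric.ball (0 : ℂ) 1, ‖P.eval z‖ ^ 2 =
      Real.pi * ∑ n ∈ P.support, ‖P.coeff n‖ ^ 2 / (n + 1) := by
  rw [setIntegral_ball_eq_integral_circleAverage (by fun_prop)]
  simp only [P.circleAverage_sq_norm_eval, Finset.mul_sum]
  rw [intervalIntegral.integral_finsetSum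
    fun n _ ↦ (by fun_prop : Continuous _).intervalIntegrable _ _]
  refine Finset.sum_congr rfl fun n _ ↦ ?_
  have h (r : ℝ) : r * (2 * Real.pi * (‖P.coeff n‖ ^ 2 * r ^ (2 * n))) =
      (2 * Real.pi * ‖P.coeff n‖ ^ 2) * r ^ (2 * n + 1) := by ring
  simp only [h]
  rw [intervalIntegral.integral_const_mul, integral_pow]
  push_cast
  field_simp
  simp
  ring

open Polynomial in
theorem Polynomial.setIntegral_ball_sq_norm_eval_mul_le (P Q : ℂ[X]) :
    ∫ z in Metric.ball (0 : ℂ) 1, ‖P.eval z * Q.eval z‖ ^ 2 ≤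
      Real.pi * (Real.circleAverage (fun z ↦ ‖P.eval z‖ ^ 2) 0 1 *
        Real.circleAverage (fun z ↦ ‖Q.eval z‖ ^ 2) 0 1) := by
  simp only [← eval_mul]
  rw [setIntegral_ball_sq_norm_eval, ← sum_sq_norm_coeff_eq_circleAverage,
    ← sum_sq_norm_coeff_eq_circleAverage]
  exact mul_le_mul_of_nonneg_left (sum_sq_norm_coeff_mul_div_le P Q) Real.pi_pos.le

open Polynomial in
/-- Polynomials are dense in the disc algebra. -/
theorem DiffContOnCl.exists_polynomial_norm_sub_le {F : ℂ → ℂ}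
    (hF : DiffContOnCl ℂ F (Metric.ball 0 1)) {ε : ℝ} (hε : 0 < ε) :
    ∃ P : ℂ[X], ∀ z ∈ Metric.closedBall (0 : ℂ) 1, ‖F z - P.eval z‖ ≤ ε := by
  have hc : ContinuousOn F (Metric.closedBall 0 1) := hF.continuousOn_ball
  obtain ⟨δ, hδ, hd⟩ := Metric.uniformContinuousOn_iff.1
    ((isCompact_closedBall (0 : ℂ) 1).uniformContinuousOn_of_continuous hc) (ε / 2) (half_pos hε)
  obtain ⟨r, hr0, hr1, hrδ⟩ : ∃ r : ℝ, 0 < r ∧ r < 1 ∧ 1 - r < δ := by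
    refine ⟨max (1 / 2) (1 - δ / 2), by positivity, max_lt (by norm_num) (by linarith), ?_⟩
    linarith [le_max_right (1 / 2) (1 - δ / 2)]
  obtain ⟨s, hrs, hs1⟩ := exists_between hr1
  lift s to NNReal using (hr0.trans hrs).le
  have hps := DiffContOnCl.hasFPowerSeriesOnBall (R := 1) (by simpa using hF) one_pos
  have hu := hps.tendstoUniformlyOn (r' := s) (by exact_mod_cast hs1)
  obtain ⟨n, hn⟩ := (Metric.tendstoUniformlyOn_iff.1 hu (ε / 2) (half_pos hε)).exists
  set p := cauchyPowerSeries F 0 (1 : NNReal)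
  refine ⟨∑ k ∈ Finset.range n, C (p.coeff k * r ^ k) * X ^ k, fun z hz ↦ ?_⟩
  have hz1 : ‖z‖ ≤ 1 := by simpa using hz
  have hrz : ‖(r : ℂ) * z‖ ≤ r := by
    rw [norm_mul, Complex.norm_real, Real.norm_of_nonneg hr0.le]
    exact mul_le_of_le_one_right hr0.le hz1
  have h1 : ‖F z - F (r * z)‖ < ε / 2 := by
    rw [← dist_eq_norm]
    refine hd z hz _ (by simpa using hrz.trans hr1.le) ?_
    rw [dist_eq_norm, show z - r * z = ((1 - r : ℝ) : ℂ) * z by push_cast; ring, norm_mul,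
      Complex.norm_real, Real.norm_of_nonneg (by linarith)]
    exact (mul_le_of_le_one_right (by linarith) hz1).trans_lt hrδ
  have h2 := hn (r * z) (by simpa using hrz.trans_lt hrs)
  have h3 : p.partialSum n (r * z) =
      (∑ k ∈ Finset.range n, C (p.coeff k * r ^ k) * X ^ k).eval z := by
    simp only [FormalMultilinearSeries.partialSum, eval_finsetSum,
      FormalMultilinearSeries.apply_eq_pow_smul_coeff, smul_eq_mul, eval_mul, eval_C, eval_pow,
      eval_X]
    exact Finset.sum_congr rfl fun k _ ↦ by ring
  rw [zero_add, dist_eq_norm, h3] at h2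
  linarith [norm_sub_le_norm_sub_add_norm_sub (F z) (F (r * z))
    ((∑ k ∈ Finset.range n, C (p.coeff k * r ^ k) * X ^ k).eval z)]

open Polynomial in
theorem DiffContOnCl.exists_seq_polynomial_tendsto {F : ℂ → ℂ}
    (hF : DiffContOnCl ℂ F (Metric.ball 0 1)) :
    ∃ (P : ℕ → ℂ[X]) (M : ℝ), (∀ n, ∀ z ∈ Metric.closedBall (0 : ℂ) 1, ‖(P n).eval z‖ ≤ M) ∧
      ∀ z ∈ Metric.closedBall (0 : ℂ) 1, Tendsto (fun n ↦ (P n).eval z) atTop (𝓝 (F z)) := by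
  choose P hP using fun n : ℕ ↦
    hF.exists_polynomial_norm_sub_le (ε := 1 / ((n : ℝ) + 1)) (by positivity)
  obtain ⟨M, hM⟩ := (isCompact_closedBall (0 : ℂ) 1).exists_bound_of_continuousOn
    hF.continuousOn_ball
  refine ⟨P, M + 1, fun n z hz ↦ ?_, fun z hz ↦ ?_⟩
  · have h1 : 1 / ((n : ℝ) + 1) ≤ 1 := by
      rw [div_le_one (by positivity)]
      simp
    linarith [hP n z hz, hM z hz, norm_le_norm_add_norm_sub (F z) ((P n).eval z)]
  · rw [tendsto_iff_norm_sub_tendsto_zero]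
    refine squeeze_zero (fun _ ↦ norm_nonneg _) (fun n ↦ ?_)
      tendsto_one_div_add_atTop_nhds_zero_nat
    rw [norm_sub_rev]
    exact hP n z hz

/-- The Carleman inequality for products in the disc algebra. -/
theorem DiffContOnCl.setIntegral_ball_sq_norm_mul_le {h k : ℂ → ℂ}
    (hh : DiffContOnCl ℂ h (Metric.ball 0 1)) (hk : DiffContOnCl ℂ k (Metric.ball 0 1)) :
    ∫ z in Metric.ball (0 : ℂ) 1, ‖h z * k z‖ ^ 2 ≤
      Real.pi * (Real.circleAverage (fun z ↦ ‖h z‖ ^ 2) 0 1 *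
        Real.circleAverage (fun z ↦ ‖k z‖ ^ 2) 0 1) := by
  obtain ⟨P, A, hPA, hP⟩ := hh.exists_seq_polynomial_tendsto
  obtain ⟨Q, B, hQB, hQ⟩ := hk.exists_seq_polynomial_tendsto
  have hA : 0 ≤ A := (norm_nonneg _).trans (hPA 0 0 (by simp))
  have circ (R : ℕ → Polynomial ℂ) (C : ℝ) (g : ℂ → ℂ)
      (hC : ∀ n, ∀ z ∈ Metric.closedBall (0 : ℂ) 1, ‖(R n).eval z‖ ≤ C)
      (hR : ∀ z ∈ Metric.closedBall (0 : ℂ) 1, Tendsto (fun n ↦ (R n).eval z) atTop (𝓝 (g z))) :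
      Tendsto (fun n ↦ Real.circleAverage (fun z ↦ ‖(R n).eval z‖ ^ 2) 0 1) atTop
        (𝓝 (Real.circleAverage (fun z ↦ ‖g z‖ ^ 2) 0 1)) := by
    have hm (θ : ℝ) : circleMap 0 1 θ ∈ Metric.closedBall (0 : ℂ) 1 :=
      circleMap_mem_closedBall _ zero_le_one _
    refine Tendsto.const_smul (intervalIntegral.tendsto_integral_filter_of_dominated_convergence
      (fun _ ↦ C ^ 2) (.of_forall fun n ↦ ?_) (.of_forall fun n ↦ .of_forall fun θ _ ↦ ?_) ?_
      (.of_forall fun θ _ ↦ ((hR _ (hm θ)).norm.pow 2))) _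
    · exact Continuous.aestronglyMeasurable (by fun_prop)
    · rw [norm_pow, norm_norm]
      gcongr
      exact hC n _ (hm θ)
    · exact intervalIntegrable_const
  have area : Tendsto (fun n ↦ ∫ z in Metric.ball (0 : ℂ) 1, ‖(P n).eval z * (Q n).eval z‖ ^ 2)
      atTop (𝓝 (∫ z in Metric.ball (0 : ℂ) 1, ‖h z * k z‖ ^ 2)) := by
    have hae : ∀ᵐ z ∂volume.restrict (Metric.ball (0 : ℂ) 1), z ∈ Metric.closedBall (0 : ℂ) 1 :=
      (ae_restrict_mem measurableSet_ball).mono fun z hz ↦ Metric.ball_subset_closedBall hz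
    refine tendsto_integral_of_dominated_convergence (fun _ ↦ (A * B) ^ 2) (fun n ↦ ?_) ?_
      (fun n ↦ ?_) ?_
    · exact Continuous.aestronglyMeasurable (by fun_prop)
    · exact integrableOn_const measure_ball_lt_top.ne
    · filter_upwards [hae] with z hz
      rw [norm_pow, norm_norm, norm_mul]
      gcongr
      exacts [hPA n z hz, hQB n z hz]
    · filter_upwards [hae] with z hz
      exact ((hP z hz).mul (hQ z hz)).norm.pow 2
  exact le_of_tendsto_of_tendsto' area
    (((circ P A h hPA hP).mul (circ Q B k hQB hQ)).const_mul _)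
    fun n ↦ (P n).setIntegral_ball_sq_norm_eval_mul_le (Q n)

/-- Real parts of entire functions are uniformly dense among the continuous real functions on the
unit circle. -/
theorem exists_differentiable_abs_re_sub_le {φ : ℂ → ℝ}
    (hφ : ContinuousOn φ (Metric.sphere 0 1)) {ε : ℝ} (hε : 0 < ε) :
    ∃ H : ℂ → ℂ, Differentiable ℂ H ∧
      ∀ z ∈ Metric.sphere (0 : ℂ) 1, |φ z - (H z).re| ≤ ε := by
  have : Fact (0 < 2 * Real.pi) := ⟨Real.two_pi_pos⟩
  have hc : Continuous fun x : AddCircle (2 * Real.pi) ↦ ((φ (AddCircle.toCircle x) : ℝ) : ℂ) := by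
    refine Complex.continuous_ofReal.comp (hφ.comp_continuous ?_ fun x ↦ ?_)
    · exact continuous_subtype_val.comp AddCircle.continuous_toCircle
    · exact (AddCircle.toCircle x).2
  have hmem : (⟨_, hc⟩ : C(AddCircle (2 * Real.pi), ℂ)) ∈
      (Submodule.span ℂ (Set.range (fourier (T := 2 * Real.pi)))).topologicalClosure := by
    rw [span_fourier_closure_eq_top]
    trivial
  obtain ⟨q, hq, hdist⟩ := Metric.mem_closure_iff.1 hmem ε hε
  have hspan : ∃ H : ℂ → ℂ, Differentiable ℂ H ∧
      ∀ x : AddCircle (2 * Real.pi), (q x).re = (H (AddCircle.toCircle x)).re := by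
    have hcoe (n : ℕ) (x : AddCircle (2 * Real.pi)) :
        fourier (n : ℤ) x = (AddCircle.toCircle x : ℂ) ^ n := by
      rw [fourier_apply, AddCircle.toCircle_zsmul, zpow_natCast, Circle.coe_pow]
    obtain ⟨c, rfl⟩ := Finsupp.mem_span_range_iff_exists_finsupp.1 hq
    have hterm (n : ℤ) : ∃ H : ℂ → ℂ, Differentiable ℂ H ∧ ∀ x : AddCircle (2 * Real.pi),
        (c n * fourier n x).re = (H (AddCircle.toCircle x)).re := by
      obtain ⟨m, rfl | rfl⟩ := n.eq_nat_or_neg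
      · exact ⟨fun z ↦ c m * z ^ m, by fun_prop, fun x ↦ by rw [hcoe]⟩
      · refine ⟨fun z ↦ (starRingEnd ℂ) (c (-m)) * z ^ m, by fun_prop, fun x ↦ ?_⟩
        rw [fourier_neg, hcoe, ← Complex.conj_re]
        simp
    choose H hH hHx using hterm
    refine ⟨fun z ↦ ∑ n ∈ c.support, H n z, by fun_prop, fun x ↦ ?_⟩
    simp [Finsupp.sum, ContinuousMap.sum_apply, Complex.re_sum, ← hHx]
  obtain ⟨H, hH, hHx⟩ := hspan
  refine ⟨H, hH, fun z hz ↦ ?_⟩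
  obtain ⟨x, hxz⟩ : ∃ x : AddCircle (2 * Real.pi), (AddCircle.toCircle x : ℂ) = z := by
    refine ⟨(z.arg : ℝ), ?_⟩
    have h := Complex.norm_mul_exp_arg_mul_I z
    rw [mem_sphere_zero_iff_norm.1 hz, Complex.ofReal_one, one_mul] at h
    rw [AddCircle.toCircle_apply_mk, Circle.coe_exp, div_self Real.two_pi_pos.ne', one_mul, h]
  rw [← hxz, ← hHx]
  have h := (ContinuousMap.dist_apply_le_dist x).trans hdist.le
  rw [dist_eq_norm] at h
  exact (Complex.abs_re_le_norm ((φ (AddCircle.toCircle x) : ℂ) - q x)).trans h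

theorem setIntegral_ball_sq_norm_le_of_differentiable {N : ℕ} {g : ℂ → EuclideanSpace ℂ (Fin N)}
    (hg : DiffContOnCl ℂ g (Metric.ball 0 1))
    {H : ℂ → ℂ} (hH : Differentiable ℂ H) :
    ∫ z in Metric.ball (0 : ℂ) 1, ‖g z‖ ^ 2 ≤
      Real.pi * (Real.circleAverage (fun z ↦ Real.exp (H z).re) 0 1 *
        Real.circleAverage (fun z ↦ ‖g z‖ ^ 2 * Real.exp (-(H z).re)) 0 1) := by
  have hexp : Differentiable ℂ fun z ↦ Complex.exp (H z / 2) := by fun_prop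
  have hexp' : Differentiable ℂ fun z ↦ Complex.exp (-(H z / 2)) := by fun_prop
  have hgj (j : Fin N) : DiffContOnCl ℂ (fun z ↦ g z j) (Metric.ball 0 1) :=
    (EuclideanSpace.proj (𝕜 := ℂ) j).differentiable.comp_diffContOnCl hg
  have hkj (j : Fin N) : DiffContOnCl ℂ (fun z ↦ Complex.exp (-(H z / 2)) * g z j)
      (Metric.ball 0 1) := hexp'.diffContOnCl.smul (hgj j)
  have hgc (j : Fin N) : ContinuousOn (fun z ↦ g z j) (Metric.closedBall 0 1) :=
    (hgj j).continuousOn_ball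
  have hkc (j : Fin N) := (hkj j).continuousOn_ball
  have hn1 (z : ℂ) : ‖Complex.exp (H z / 2)‖ ^ 2 = Real.exp (H z).re := by
    rw [Complex.norm_exp, ← Real.exp_nat_mul]
    simp
    ring
  have hn2 (z : ℂ) : ‖Complex.exp (-(H z / 2))‖ ^ 2 = Real.exp (-(H z).re) := by
    rw [Complex.norm_exp, ← Real.exp_nat_mul]
    simp
    ring
  have hprod (j : Fin N) (z : ℂ) :
      Complex.exp (H z / 2) * (Complex.exp (-(H z / 2)) * g z j) = g z j := by
    rw [← mul_assoc, ← Complex.exp_add, add_neg_cancel, Complex.exp_zero, one_mul]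
  calc ∫ z in Metric.ball (0 : ℂ) 1, ‖g z‖ ^ 2
      = ∑ j, ∫ z in Metric.ball (0 : ℂ) 1, ‖g z j‖ ^ 2 := by
        simp only [EuclideanSpace.norm_sq_eq]
        refine integral_finsetSum _ fun j _ ↦ ?_
        exact (((hgc j).norm.pow 2).integrableOn_compact (isCompact_closedBall _ _)).mono_set
          Metric.ball_subset_closedBall
    _ ≤ ∑ j, Real.pi * (Real.circleAverage (fun z ↦ Real.exp (H z).re) 0 1 *
          Real.circleAverage (fun z ↦ ‖Complex.exp (-(H z / 2)) * g z j‖ ^ 2) 0 1) := by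
        refine Finset.sum_le_sum fun j _ ↦ ?_
        simpa only [hprod, hn1] using hexp.diffContOnCl.setIntegral_ball_sq_norm_mul_le (hkj j)
    _ = _ := by
        rw [← Finset.mul_sum, ← Finset.mul_sum, ← Real.circleAverage_fun_sum]
        · simp only [norm_mul, mul_pow, hn2, EuclideanSpace.norm_sq_eq, Finset.mul_sum, mul_comm]
        · intro j _
          refine ContinuousOn.circleIntegrable zero_le_one ?_
          exact ((hkc j).norm.pow 2).mono Metric.sphere_subset_closedBall

/-- Choosing `Re H` close to `log (‖g‖ + ε)` on the circle balances the two weighted boundary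
integrals of the previous lemma. -/
theorem setIntegral_ball_sq_norm_le {N : ℕ} {g : ℂ → EuclideanSpace ℂ (Fin N)}
    (hg : DiffContOnCl ℂ g (Metric.ball 0 1)) :
    ∫ z in Metric.ball (0 : ℂ) 1, ‖g z‖ ^ 2 ≤
      Real.pi * Real.circleAverage (fun z ↦ ‖g z‖) 0 1 ^ 2 := by
  set A := Real.circleAverage (fun z ↦ ‖g z‖) 0 1 with hA
  have hgs : ContinuousOn g (Metric.sphere 0 1) :=
    hg.continuousOn_ball.mono Metric.sphere_subset_closedBall
  have hA0 : 0 ≤ A := Real.circleAverage_nonneg_of_nonneg fun z _ ↦ norm_nonneg _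
  have key (ε : ℝ) (hε : 0 < ε) : ∫ z in Metric.ball (0 : ℂ) 1, ‖g z‖ ^ 2 ≤
      Real.pi * (Real.exp ε * (A + ε) * (Real.exp ε * A)) := by
    have hpos (z : ℂ) : 0 < ‖g z‖ + ε := by positivity
    obtain ⟨H, hH, happ⟩ := exists_differentiable_abs_re_sub_le (φ := fun z ↦ Real.log (‖g z‖ + ε))
      ((hgs.norm.add continuousOn_const).log fun z _ ↦ (hpos z).ne') hε
    have hHc : Continuous H := hH.continuous
    refine (setIntegral_ball_sq_norm_le_of_differentiable hg hH).trans ?_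
    have h1 : Real.circleAverage (fun z ↦ Real.exp (H z).re) 0 1 ≤ Real.exp ε * (A + ε) := by
      rw [hA, ← Real.circleAverage_const ε 0 1, ← Real.circleAverage_fun_add,
        ← smul_eq_mul, ← Real.circleAverage_fun_smul, Real.circleAverage_const]
      · refine Real.circleAverage_mono ?_ ?_ fun z hz ↦ ?_
        · exact ContinuousOn.circleIntegrable zero_le_one (by fun_prop)
        · exact ContinuousOn.circleIntegrable zero_le_one (by fun_prop)
        · rw [abs_one] at hz
          rw [smul_eq_mul, ← Real.exp_log (hpos z), ← Real.exp_add]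
          gcongr
          linarith [(abs_le.1 (happ z hz)).1]
      · exact ContinuousOn.circleIntegrable zero_le_one (by fun_prop)
      · exact ContinuousOn.circleIntegrable zero_le_one (by fun_prop)
    have h2 : Real.circleAverage (fun z ↦ ‖g z‖ ^ 2 * Real.exp (-(H z).re)) 0 1 ≤
        Real.exp ε * A := by
      rw [hA, ← smul_eq_mul, ← Real.circleAverage_fun_smul]
      refine Real.circleAverage_mono ?_ ?_ fun z hz ↦ ?_
      · exact ContinuousOn.circleIntegrable zero_le_one (by fun_prop)
      · exact ContinuousOn.circleIntegrable zero_le_one (by fun_prop)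
      · rw [abs_one] at hz
        have h3 : Real.exp (-(H z).re) ≤ Real.exp ε / (‖g z‖ + ε) := by
          rw [← Real.exp_log (hpos z), ← Real.exp_sub]
          gcongr
          linarith [(abs_le.1 (happ z hz)).2]
        calc ‖g z‖ ^ 2 * Real.exp (-(H z).re)
            ≤ ‖g z‖ * (‖g z‖ + ε) * (Real.exp ε / (‖g z‖ + ε)) := by
              gcongr
              nlinarith [norm_nonneg (g z)]
          _ = Real.exp ε • ‖g z‖ := by
              have := (hpos z).ne'
              rw [smul_eq_mul]
              field_simp
    gcongr
    exact Real.circleAverage_nonneg_of_nonneg fun z _ ↦ by positivity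
  have hlim : Tendsto (fun ε ↦ Real.pi * (Real.exp ε * (A + ε) * (Real.exp ε * A))) (𝓝[>] 0)
      (𝓝 (Real.pi * A ^ 2)) := by
    refine tendsto_nhdsWithin_of_tendsto_nhds (Continuous.tendsto' (by fun_prop) _ _ ?_)
    simp
    ring
  exact ge_of_tendsto hlim (eventually_mem_nhdsWithin.mono fun ε hε ↦ key ε hε)



/-- Isoperimetric inequality for holomorphic discs (used in Lemmas 6.1 and 6.3): for
`f : ℂ → ℂ^N` continuously differentiable in the real sense on a neighborhood of the
closed unit disc and holomorphic on the open unit disc,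
`4π ∫_{|z|<1} ‖f'‖² dA ≤ (∫₀^{2π} ‖f'(e^{iθ})‖ dθ)²`, i.e. the area of the disc is at most
`1/(4π)` times the square of the length of its boundary curve.  (Here `f'` is expressed as
the partial derivative `∂ₓ f`, which on the closed disc is the continuous extension of the
complex derivative.) -/
theorem isoperimetric_inequality_holomorphic_disc
    (N : ℕ) (f : ℂ → EuclideanSpace ℂ (Fin N)) (U : Set ℂ)
    (hU : IsOpen U) (hDU : Metric.closedBall (0 : ℂ) 1 ⊆ U)
    (hf : ContDiffOn ℝ 1 f U)
    (hdiff : ∀ z : ℂ, ‖z‖ < 1 → DifferentiableAt ℂ f z) :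
    4 * Real.pi * (∫ z in Metric.ball (0 : ℂ) 1, ‖fderiv ℝ f z 1‖ ^ 2) ≤
      (∫ θ in (0 : ℝ)..(2 * Real.pi),
        ‖fderiv ℝ f (Complex.exp (θ * Complex.I)) 1‖) ^ 2 := by
  have hderiv : ∀ z ∈ Metric.ball (0 : ℂ) 1, fderiv ℝ f z 1 = deriv f z := by
    intro z hz
    rw [(hdiff z (by simpa using hz)).fderiv_restrictScalars ℝ]
    simp
  have hg : DiffContOnCl ℂ (fun z ↦ fderiv ℝ f z 1) (Metric.ball 0 1) := by
    constructor
    · refine DifferentiableOn.congr ?_ hderiv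
      refine DifferentiableOn.deriv (fun z hz ↦ ?_) Metric.isOpen_ball
      exact (hdiff z (by simpa using hz)).differentiableWithinAt
    · rw [closure_ball _ one_ne_zero]
      exact ((hf.continuousOn_fderiv_of_isOpen hU le_rfl).mono hDU).clm_apply continuousOn_const
  have hcirc : ∫ θ in (0 : ℝ)..(2 * Real.pi), ‖fderiv ℝ f (Complex.exp (θ * Complex.I)) 1‖ =
      2 * Real.pi * Real.circleAverage (fun z ↦ ‖fderiv ℝ f z 1‖) 0 1 := by
    rw [Real.circleAverage_def, smul_eq_mul, mul_inv_cancel_left₀ Real.two_pi_pos.ne']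
    simp [circleMap]
  rw [hcirc]
  calc _ ≤ 4 * Real.pi * (Real.pi * Real.circleAverage (fun z ↦ ‖fderiv ℝ f z 1‖) 0 1 ^ 2) :=
        mul_le_mul_of_nonneg_left (setIntegral_ball_sq_norm_le hg) (by positivity)
    _ = _ := by ring
end
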